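/- arXiv:1912.10378 — 5 statements merged into one kernel-verified Lean document; each statement's English description precedes it below -/
import Mathlib

section
/- Let I ⊆ ℝ be an open interval, g : I → (0,∞) a continuous strictly monotone bijection, α ∈ (0,1), and define t σ s := g(α g^{−1}(t) + (1−α) g^{−1}(s)) for s, t > 0. Let f : (0,∞) → (0,∞) be continuous with f(1) = 1. Then the following are equivalent: (I) f(t σ s) = f(t) σ f(s) for all t, s > 0; (II) there exists β ∈ ℝ such that β g^{−1}(t) + (1−β) g^{−1}(1) ∈ I and f(t) = g(β g^{−1}(t) + (1−β) g^{−1}(1)) for all t > 0. -/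
open Matrix Filter Set Topology
open scoped ComplexOrder

noncomputable def matFun {n : ℕ} (f : ℝ → ℝ) (A : Matrix (Fin n) (Fin n) ℂ) :
    Matrix (Fin n) (Fin n) ℂ := cfc f A

def loewnerLE {n : ℕ} (A B : Matrix (Fin n) (Fin n) ℂ) : Prop := (B - A).PosSemidef

def OpMonotone (f : ℝ → ℝ) : Prop :=
  ∀ (n : ℕ) (A B : Matrix (Fin n) (Fin n) ℂ), A.PosDef → B.PosDef →
    loewnerLE A B → loewnerLE (matFun f A) (matFun f B)

def OMone (f : ℝ → ℝ) : Prop :=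
  (∀ t : ℝ, 0 < t → 0 < f t) ∧ f 1 = 1 ∧ OpMonotone f

noncomputable def kuboMean {n : ℕ} (Φ : ℝ → ℝ) (A B : Matrix (Fin n) (Fin n) ℂ) :
    Matrix (Fin n) (Fin n) ℂ :=
  matFun Real.sqrt A *
    matFun Φ (matFun (fun x => (Real.sqrt x)⁻¹) A * B * matFun (fun x => (Real.sqrt x)⁻¹) A) *
    matFun Real.sqrt A

def Subpreserves (Φ f : ℝ → ℝ) : Prop :=
  ∀ (n : ℕ) (A B : Matrix (Fin n) (Fin n) ℂ), A.PosDef → B.PosDef →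
    loewnerLE (matFun f (kuboMean Φ A B)) (kuboMean Φ (matFun f A) (matFun f B))

def PreservesMean (Φ f : ℝ → ℝ) : Prop :=
  ∀ (n : ℕ) (A B : Matrix (Fin n) (Fin n) ℂ), A.PosDef → B.PosDef →
    matFun f (kuboMean Φ A B) = kuboMean Φ (matFun f A) (matFun f B)

def OMTrivial (f : ℝ → ℝ) : Prop :=
  (∀ t : ℝ, 0 < t → f t = 1) ∨ (∀ t : ℝ, 0 < t → f t = t)

noncomputable def adjFun (f : ℝ → ℝ) : ℝ → ℝ := fun t => (f t⁻¹)⁻¹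

noncomputable def transFun (f : ℝ → ℝ) : ℝ → ℝ := fun t => t * f t⁻¹


/-- A continuous function on `[a, b]` that respects one fixed weighted mean satisfies the
maximum principle. -/
theorem nonpos_of_weighted_mean {α a b : ℝ} (hα : α ∈ Set.Ioo (0 : ℝ) 1) {φ : ℝ → ℝ}
    (hφ : ContinuousOn φ (Set.Icc a b)) (ha : φ a ≤ 0) (hb : φ b ≤ 0)
    (hmean : ∀ x ∈ Set.Icc a b, ∀ y ∈ Set.Icc a b,
      φ (α * x + (1 - α) * y) = α * φ x + (1 - α) * φ y) :
    ∀ x ∈ Set.Icc a b, φ x ≤ 0 := by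
  obtain ⟨hα0, hα1⟩ := hα
  intro x hx
  by_contra! hpos
  obtain ⟨m, hm, hmax⟩ := isCompact_Icc.exists_isMaxOn ⟨x, hx⟩ hφ
  have hM : 0 < φ m := hpos.trans_le (hmax hx)
  have hclosed : IsClosed (Set.Icc a b ∩ φ ⁻¹' {φ m}) :=
    hφ.preimage_isClosed_of_isClosed isClosed_Icc isClosed_singleton
  have hcompact : IsCompact (Set.Icc a b ∩ φ ⁻¹' {φ m}) :=
    isCompact_Icc.of_isClosed_subset hclosed Set.inter_subset_left
  obtain ⟨z, ⟨⟨haz, hzb⟩, hz⟩, hzmax⟩ := hcompact.exists_isGreatest ⟨m, hm, rfl⟩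
  have hz : φ z = φ m := hz
  have haz : a < z := lt_of_le_of_ne haz fun h => by rw [← h] at hz; linarith
  have hzb : z < b := lt_of_le_of_ne hzb fun h => by rw [h] at hz; linarith
  obtain ⟨ε, hε, hεa, hεb⟩ : ∃ ε > 0, ε ≤ z - a ∧ ε ≤ b - z :=
    ⟨min (z - a) (b - z), lt_min (by linarith) (by linarith), min_le_left _ _, min_le_right _ _⟩
  have hu : z + (1 - α) * ε ∈ Set.Icc a b := ⟨by nlinarith, by nlinarith⟩
  have hv : z - α * ε ∈ Set.Icc a b := ⟨by nlinarith, by nlinarith⟩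
  have hfz := hmean _ hu _ hv
  rw [show α * (z + (1 - α) * ε) + (1 - α) * (z - α * ε) = z by ring] at hfz
  have hum : φ (z + (1 - α) * ε) ≤ φ m := hmax hu
  have hvm : φ (z - α * ε) ≤ φ m := hmax hv
  have heq : φ (z + (1 - α) * ε) = φ m := by
    refine le_antisymm hum (le_of_not_gt fun hlt => ?_)
    nlinarith [mul_lt_mul_of_pos_left hlt hα0,
      mul_le_mul_of_nonneg_left hvm (sub_nonneg.2 hα1.le)]
  have := hzmax ⟨hu, heq⟩
  nlinarith [mul_pos (sub_pos.2 hα1) hε]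

/-- A continuous function on `[a, b]` that respects one fixed weighted mean is its own chord. -/
theorem eq_chord_of_weighted_mean {α a b : ℝ} (hα : α ∈ Set.Ioo (0 : ℝ) 1) {h : ℝ → ℝ}
    (hh : ContinuousOn h (Set.Icc a b))
    (hmean : ∀ x ∈ Set.Icc a b, ∀ y ∈ Set.Icc a b,
      h (α * x + (1 - α) * y) = α * h x + (1 - α) * h y) :
    ∀ x ∈ Set.Icc a b, (b - a) * h x = (b - x) * h a + (x - a) * h b := by
  intro x hx
  have hcont : ContinuousOn (fun t => (b - a) * h t - ((b - t) * h a + (t - a) * h b))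
      (Set.Icc a b) := by fun_prop
  have hle := nonpos_of_weighted_mean hα hcont (by simp) (by simp)
    (fun s hs t ht => by simp only [hmean s hs t ht]; ring) x hx
  have hge := nonpos_of_weighted_mean hα hcont.neg (by simp) (by simp)
    (fun s hs t ht => by simp only [Pi.neg_apply, hmean s hs t ht]; ring) x hx
  simp only [Pi.neg_apply] at hle hge
  linarith

/-- On an interval, the continuous functions respecting one fixed weighted mean are affine. -/
theorem collinear_of_weighted_mean {I : Set ℝ} (hI : I.OrdConnected) {α : ℝ}
    (hα : α ∈ Set.Ioo (0 : ℝ) 1) {h : ℝ → ℝ} (hh : ContinuousOn h I)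
    (hmean : ∀ x ∈ I, ∀ y ∈ I, h (α * x + (1 - α) * y) = α * h x + (1 - α) * h y)
    {a b x : ℝ} (ha : a ∈ I) (hb : b ∈ I) (hx : x ∈ I) :
    (b - a) * h x = (b - x) * h a + (x - a) * h b := by
  have key : ∀ {p q r : ℝ}, p ∈ I → r ∈ I → p ≤ q → q ≤ r →
      (r - p) * h q = (r - q) * h p + (q - p) * h r := fun hp hr hpq hqr =>
    have hsub := hI.out hp hr
    eq_chord_of_weighted_mean hα (hh.mono hsub)
      (fun s hs t ht => hmean s (hsub hs) t (hsub ht)) _ ⟨hpq, hqr⟩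
  rcases le_total a b with hab | hab <;> rcases le_total a x with hax | hax <;>
    rcases le_total b x with hbx | hbx
  · linarith [key ha hx hab hbx]
  · linarith [key ha hb hax hbx]
  · linarith [key ha hx hab hbx]
  · linarith [key hx hb hax hab]
  · linarith [key hb hx hab hax]
  · linarith [key hb hx hab hax]
  · linarith [key hb ha hbx hax]
  · linarith [key hx ha hbx hab]

/-- The inverse of a strictly monotone bijection between open sets of reals is continuous. -/
theorem continuousOn_inverse_of_strictMonoOn {I J : Set ℝ} (hI : IsOpen I) (hJ : IsOpen J)
    {g ginv : ℝ → ℝ} (hgmono : StrictMonoOn g I) (hg : Set.MapsTo g I J)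
    (hginv : Set.MapsTo ginv J I) (hinv : Set.InvOn ginv g I J) : ContinuousOn ginv J := by
  have hmono : StrictMonoOn ginv J := fun s hs t ht hst => by
    rwa [← hgmono.lt_iff_lt (hginv hs) (hginv ht), hinv.2 hs, hinv.2 ht]
  have himage : ginv '' J = I := (hinv.symm.bijOn hginv hg).image_eq
  refine fun t ht => ContinuousAt.continuousWithinAt ?_
  exact hmono.continuousAt_of_image_mem_nhds (hJ.mem_nhds ht)
    (himage ▸ hI.mem_nhds (hginv ht))

/-- The inverse of a strictly antitone bijection between open sets of reals is continuous. -/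
theorem continuousOn_inverse_of_strictAntiOn {I J : Set ℝ} (hI : IsOpen I) (hJ : IsOpen J)
    {g ginv : ℝ → ℝ} (hganti : StrictAntiOn g I) (hg : Set.MapsTo g I J)
    (hginv : Set.MapsTo ginv J I) (hinv : Set.InvOn ginv g I J) : ContinuousOn ginv J := by
  have hcont : ContinuousOn (fun t => -ginv t) J :=
    continuousOn_inverse_of_strictMonoOn (g := fun x => g (-x)) (hI.preimage continuous_neg) hJ
      (fun x hx y hy hxy => hganti hy hx (neg_lt_neg hxy)) (fun x hx => hg hx)
      (fun t ht => by simpa using hginv ht)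
      ⟨fun x hx => neg_eq_iff_eq_neg.2 (hinv.1 hx), fun t ht => by simpa using hinv.2 ht⟩
  exact hcont.neg.congr fun t _ => (neg_neg (ginv t)).symm

theorem stmt_12 (I : Set ℝ) (hIopen : IsOpen I) (hIconn : I.OrdConnected)
    (g : ℝ → ℝ) (hgcont : ContinuousOn g I)
    (hgmono : StrictMonoOn g I ∨ StrictAntiOn g I)
    (hgbij : Set.BijOn g I (Set.Ioi 0))
    (ginv : ℝ → ℝ) (hginv : Set.InvOn ginv g I (Set.Ioi 0))
    (α : ℝ) (hα : α ∈ Set.Ioo (0 : ℝ) 1)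
    (f : ℝ → ℝ) (hfcont : ContinuousOn f (Set.Ioi 0))
    (hfpos : ∀ t : ℝ, 0 < t → 0 < f t) (hf1 : f 1 = 1) :
    (∀ t s : ℝ, 0 < t → 0 < s →
        f (g (α * ginv t + (1 - α) * ginv s)) = g (α * ginv (f t) + (1 - α) * ginv (f s))) ↔
      ∃ β : ℝ, ∀ t : ℝ, 0 < t →
        β * ginv t + (1 - β) * ginv 1 ∈ I ∧ f t = g (β * ginv t + (1 - β) * ginv 1) := by
  have hmaps : Set.MapsTo ginv (Set.Ioi 0) I := fun t ht => by
    obtain ⟨x, hx, rfl⟩ := hgbij.surjOn ht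
    rwa [hginv.1 hx]
  have hconv : ∀ x ∈ I, ∀ y ∈ I, α * x + (1 - α) * y ∈ I := fun x hx y hy =>
    hIconn.convex hx hy hα.1.le (sub_nonneg.2 hα.2.le) (by ring)
  constructor
  · intro hf
    have hginvcont : ContinuousOn ginv (Set.Ioi 0) := hgmono.elim
      (continuousOn_inverse_of_strictMonoOn hIopen isOpen_Ioi · hgbij.mapsTo hmaps hginv)
      (continuousOn_inverse_of_strictAntiOn hIopen isOpen_Ioi · hgbij.mapsTo hmaps hginv)
    have hfmaps : Set.MapsTo f (Set.Ioi 0) (Set.Ioi 0) := hfpos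
    have hcont : ContinuousOn (fun x => ginv (f (g x))) I :=
      hginvcont.comp (hfcont.comp hgcont hgbij.mapsTo) (hfmaps.comp hgbij.mapsTo)
    have hmean : ∀ x ∈ I, ∀ y ∈ I, ginv (f (g (α * x + (1 - α) * y))) =
        α * ginv (f (g x)) + (1 - α) * ginv (f (g y)) := fun x hx y hy => by
      have hxy := hf _ _ (hgbij.mapsTo hx) (hgbij.mapsTo hy)
      rw [hginv.1 hx, hginv.1 hy] at hxy
      rw [hxy]
      exact hginv.1 (hconv _ (hmaps (hfpos _ (hgbij.mapsTo hx)))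
        _ (hmaps (hfpos _ (hgbij.mapsTo hy))))
    have hone : (1 : ℝ) ∈ Set.Ioi 0 := Set.mem_Ioi.2 one_pos
    have htwo : (2 : ℝ) ∈ Set.Ioi 0 := Set.mem_Ioi.2 two_pos
    have hne : ginv 2 - ginv 1 ≠ 0 := fun h => by
      have h21 := congrArg g (sub_eq_zero.1 h)
      rw [hginv.2 hone, hginv.2 htwo] at h21
      norm_num at h21
    refine ⟨(ginv (f 2) - ginv 1) / (ginv 2 - ginv 1), fun t ht => ?_⟩
    have hline := collinear_of_weighted_mean hIconn hα hcont hmean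
      (hmaps hone) (hmaps htwo) (hmaps ht)
    simp only [hginv.2 hone, hginv.2 htwo, hginv.2 ht, hf1] at hline
    have heq : (ginv (f 2) - ginv 1) / (ginv 2 - ginv 1) * ginv t +
        (1 - (ginv (f 2) - ginv 1) / (ginv 2 - ginv 1)) * ginv 1 = ginv (f t) := by
      field_simp
      linarith
    rw [heq]
    exact ⟨hmaps (hfpos t ht), (hginv.2 (hfpos t ht)).symm⟩
  · rintro ⟨β, hβ⟩ t s ht hs
    have hmem := hconv _ (hmaps ht) _ (hmaps hs)
    rw [(hβ _ (hgbij.mapsTo hmem)).2, (hβ t ht).2, (hβ s hs).2, hginv.1 hmem,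
      hginv.1 (hβ t ht).1, hginv.1 (hβ s hs).1]
    congr 1
    ring
end

section
/- Let f ∈ OM_+^1 and α ∈ (0,1). Then the following are equivalent: (I) f(t^α s^{1−α}) = f(t)^α f(s)^{1−α} for all t, s > 0; (II) there exists β ∈ [0,1] such that f(t) = t^β for all t > 0. -/
open Matrix Filter Set Topology
open scoped ComplexOrder

theorem posSemidef_fin_two {a b d : ℝ} (ha : 0 < a) (h : b ^ 2 ≤ a * d) :
    (!![(a : ℂ), b; b, d]).PosSemidef := by
  have hd : 0 ≤ d - b ^ 2 / a := by
    rw [sub_nonneg, div_le_iff₀ ha]; linarith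
  have h1 := (Matrix.posSemidef_vecMulVec_self_star ![(a : ℂ), b]).smul
    (Complex.zero_le_real.2 (inv_nonneg.2 ha.le))
  have h2 : (Matrix.diagonal ![(0 : ℂ), ((d - b ^ 2 / a : ℝ) : ℂ)]).PosSemidef := by
    refine Matrix.PosSemidef.diagonal fun i => ?_
    fin_cases i
    · simp
    · exact Complex.zero_le_real.2 hd
  convert h1.add h2 using 1
  have ha' : (a : ℂ) ≠ 0 := by exact_mod_cast ha.ne'
  ext i j
  rw [Matrix.add_apply, Matrix.smul_apply, Matrix.vecMulVec_apply]
  fin_cases i <;> fin_cases j <;> simp <;> field_simp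
  ring

theorem posDef_fin_two {a b d : ℝ} (ha : 0 < a) (h : b ^ 2 < a * d) :
    (!![(a : ℂ), b; b, d]).PosDef := by
  refine (posSemidef_fin_two ha h.le).posDef_iff_det_ne_zero.2 ?_
  rw [Matrix.det_fin_two_of]
  norm_cast
  nlinarith

theorem cfc_eq_affine_of_quadratic {n : ℕ} [NeZero n] (f : ℝ → ℝ) (a b k : ℝ)
    (hk : k * (a - b) = f a - f b) (A : Matrix (Fin n) (Fin n) ℂ) (hA : A.IsHermitian)
    (hq : (A - algebraMap ℝ _ a) * (A - algebraMap ℝ _ b) = 0) :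
    cfc f A = algebraMap ℝ _ (f b - k * b) + k • A := by
  have hsa : IsSelfAdjoint A := hA
  have hspec : (spectrum ℝ A).EqOn f (fun x => (f b - k * b) + k * x) := by
    intro x hx
    have h := spectrum.subset_polynomial_aeval A
      ((Polynomial.X - Polynomial.C a) * (Polynomial.X - Polynomial.C b)) ⟨x, hx, rfl⟩
    simp only [map_mul, map_sub, Polynomial.aeval_X, Polynomial.aeval_C, hq,
      spectrum.zero_eq, Set.mem_singleton_iff, Polynomial.eval_mul, Polynomial.eval_sub,
      Polynomial.eval_X, Polynomial.eval_C, mul_eq_zero, sub_eq_zero] at h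
    rcases h with rfl | rfl
    · change f x = _
      linarith
    · change f x = _
      ring
  rw [cfc_congr hspec, cfc_const_add _ _ _, cfc_const_mul_id k A]

theorem OpMonotone.add_le_two_mul {f : ℝ → ℝ} (hf : OpMonotone f) {a b x : ℝ}
    (ha : 0 < a) (hb : 0 < b) (hx : a + b < 2 * x) : f a + f b ≤ 2 * f x := by
  obtain ⟨p, hp⟩ : ∃ p, p = (a + b) / 2 := ⟨_, rfl⟩
  obtain ⟨q, hq⟩ : ∃ q, q = (a - b) / 2 := ⟨_, rfl⟩
  obtain rfl : a = p + q := by linarith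
  obtain rfl : b = p - q := by linarith
  have hpx : 0 < x - p := by linarith
  obtain ⟨y, hy⟩ : ∃ y, y = p + q ^ 2 / (x - p) := ⟨_, rfl⟩
  have hyp : (x - p) * (y - p) = q ^ 2 := by rw [hy]; field_simp; ring
  have hyp0 : 0 ≤ y - p := by rw [hy]; simp; positivity
  obtain ⟨A, hA⟩ : ∃ A : Matrix (Fin 2) (Fin 2) ℂ, A = !![(p : ℂ), q; q, p] := ⟨_, rfl⟩
  obtain ⟨B, hB⟩ : ∃ B : Matrix (Fin 2) (Fin 2) ℂ, B = !![(x : ℂ), 0; 0, y] := ⟨_, rfl⟩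
  have hAP : A.PosDef := by
    rw [hA]; exact posDef_fin_two (by linarith) (by nlinarith)
  have hBP : B.PosDef := by
    have := posDef_fin_two (a := x) (b := 0) (d := y) (by linarith)
      (by rw [zero_pow two_ne_zero]; exact mul_pos (by linarith) (by linarith))
    rwa [Complex.ofReal_zero, ← hB] at this
  have hle : loewnerLE A B := by
    have := posSemidef_fin_two (b := -q) hpx (by rw [neg_sq, hyp])
    rw [loewnerLE, hA, hB]
    convert this using 1
    ext i j; fin_cases i <;> fin_cases j <;> simp
  have key := hf 2 A B hAP hBP hle
  obtain ⟨k, hk⟩ : ∃ k, k * ((p + q) - (p - q)) = f (p + q) - f (p - q) := by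
    by_cases h : q = 0
    · exact ⟨0, by simp [h]⟩
    · exact ⟨(f (p + q) - f (p - q)) / (2 * q), by field_simp; ring⟩
  obtain ⟨l, hl⟩ : ∃ l, l * (x - y) = f x - f y := by
    by_cases h : x - y = 0
    · exact ⟨0, by simp [sub_eq_zero.1 h]⟩
    · exact ⟨(f x - f y) / (x - y), by field_simp⟩
  have hfA := cfc_eq_affine_of_quadratic f _ _ k hk A hAP.isHermitian (by
    rw [hA]; ext i j
    fin_cases i <;> fin_cases j <;>
      simp [Matrix.mul_apply, Matrix.algebraMap_matrix_apply])
  have hfB := cfc_eq_affine_of_quadratic f _ _ l hl B hBP.isHermitian (by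
    rw [hB]; ext i j
    fin_cases i <;> fin_cases j <;>
      simp [Matrix.mul_apply, Matrix.algebraMap_matrix_apply])
  have h0 := key.diag_nonneg (i := 0)
  rw [matFun, matFun, hfA, hfB, hA, hB, Algebra.algebraMap_eq_smul_one,
    Algebra.algebraMap_eq_smul_one] at h0
  simp at h0
  norm_cast at h0
  linarith

theorem OpMonotone.monotoneOn {f : ℝ → ℝ} (hf : OpMonotone f) : MonotoneOn f (Set.Ioi 0) := by
  intro s hs t _ hst
  rcases hst.eq_or_lt with rfl | h
  · exact le_rfl
  · linarith [hf.add_le_two_mul hs hs (x := t) (by linarith)]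

theorem exponent_le_one_of_opMonotone {f : ℝ → ℝ} {β : ℝ} (hf : OpMonotone f)
    (h : ∀ t : ℝ, 0 < t → f t = t ^ β) : β ≤ 1 := by
  by_contra! hβ
  have h2 : (2 : ℝ) ^ (1 / β) < 2 := by
    conv_rhs => rw [← Real.rpow_one 2]
    exact Real.rpow_lt_rpow_of_exponent_lt (by norm_num) (by rw [div_lt_one] <;> linarith)
  obtain ⟨c, hc, hc2⟩ := exists_between h2
  have hc0 : 0 < c := lt_trans (by positivity) hc
  have hcb : 2 < c ^ β := by
    have := Real.rpow_lt_rpow (by positivity) hc (by linarith : 0 < β)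
    rwa [← Real.rpow_mul (by norm_num), one_div_mul_cancel (by linarith), Real.rpow_one] at this
  have he : 0 < (2 - c) / 2 := by linarith
  have := hf.add_le_two_mul hc0 he (x := 1) (by linarith)
  rw [h _ hc0, h _ he, h _ one_pos, Real.one_rpow] at this
  linarith [Real.rpow_pos_of_pos he β]

theorem Monotone.eq_mul_of_map_add {g : ℝ → ℝ} (hg : Monotone g)
    (hadd : ∀ x y, g (x + y) = g x + g y) (x : ℝ) : g x = x * g 1 := by
  let G : ℝ →+ ℝ := AddMonoidHom.mk' g hadd
  have hrat (r : ℚ) : g r = r * g 1 := by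
    have := map_rat_smul G r (1 : ℝ)
    simpa [G, Rat.smul_def] using this
  have h1 : 0 ≤ g 1 := by
    have := hg (zero_le_one (α := ℝ))
    have h0 := hrat 0
    simp at h0
    linarith
  apply le_antisymm
  · refine le_of_forall_pos_le_add fun ε hε => ?_
    have hδ : 0 < ε / (g 1 + 1) := by positivity
    obtain ⟨r, hr, hr'⟩ := exists_rat_btwn (show x < x + ε / (g 1 + 1) by linarith)
    have h2 := hg hr.le
    rw [hrat] at h2
    have h3 : ε / (g 1 + 1) * g 1 ≤ ε := by
      rw [div_mul_eq_mul_div, div_le_iff₀ (by positivity)]; nlinarith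
    nlinarith [mul_le_mul_of_nonneg_right hr'.le h1]
  · refine le_of_forall_pos_le_add fun ε hε => ?_
    have hδ : 0 < ε / (g 1 + 1) := by positivity
    obtain ⟨r, hr, hr'⟩ := exists_rat_btwn (show x - ε / (g 1 + 1) < x by linarith)
    have h2 := hg hr'.le
    rw [hrat] at h2
    have h3 : ε / (g 1 + 1) * g 1 ≤ ε := by
      rw [div_mul_eq_mul_div, div_le_iff₀ (by positivity)]; nlinarith
    nlinarith [mul_le_mul_of_nonneg_right hr.le h1]

theorem stmt_13 (f : ℝ → ℝ) (hf : OMone f) (α : ℝ) (hα : α ∈ Set.Ioo (0 : ℝ) 1) :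
    (∀ t s : ℝ, 0 < t → 0 < s → f (t ^ α * s ^ (1 - α)) = f t ^ α * f s ^ (1 - α)) ↔
      ∃ β ∈ Set.Icc (0 : ℝ) 1, ∀ t : ℝ, 0 < t → f t = t ^ β := by
  obtain ⟨hpos, h1, hop⟩ := hf
  obtain ⟨hα0, hα1⟩ := hα
  have hα' : 0 < 1 - α := by linarith
  constructor
  · intro h
    let g : ℝ → ℝ := fun x => Real.log (f (Real.exp x))
    have hcomb (x y : ℝ) : g (α * x + (1 - α) * y) = α * g x + (1 - α) * g y := by
      have hx := hpos _ (Real.exp_pos x)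
      have hy := hpos _ (Real.exp_pos y)
      have := h _ _ (Real.exp_pos x) (Real.exp_pos y)
      rw [← Real.exp_mul, ← Real.exp_mul, ← Real.exp_add] at this
      simp only [g]
      rw [mul_comm α, mul_comm (1 - α) y, this, Real.log_mul (by positivity) (by positivity),
        Real.log_rpow hx, Real.log_rpow hy]
    have hg0 : g 0 = 0 := by simp [g, h1]
    have hadd (x y : ℝ) : g (x + y) = g x + g y := by
      have e1 := hcomb (x / α) 0
      have e2 := hcomb 0 (y / (1 - α))
      have e3 := hcomb (x / α) (y / (1 - α))
      rw [mul_div_cancel₀ _ hα0.ne'] at e1 e3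
      rw [mul_div_cancel₀ _ hα'.ne'] at e2 e3
      simp only [hg0, mul_zero, add_zero, zero_add] at e1 e2
      rw [e3, e1, e2]
    have hmono : Monotone g := fun x y hxy =>
      Real.log_le_log (hpos _ (Real.exp_pos x))
        (hop.monotoneOn (Real.exp_pos x) (Real.exp_pos y) (Real.exp_le_exp.2 hxy))
    have hform (t : ℝ) (ht : 0 < t) : f t = t ^ g 1 := by
      have := hmono.eq_mul_of_map_add hadd (Real.log t)
      rw [Real.rpow_def_of_pos ht, ← this]
      simp only [g]
      rw [Real.exp_log ht, Real.exp_log (hpos t ht)]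
    exact ⟨g 1, ⟨hg0 ▸ hmono zero_le_one, exponent_le_one_of_opMonotone hop hform⟩, hform⟩
  · rintro ⟨β, -, h⟩ t s ht hs
    rw [h _ (by positivity), h t ht, h s hs, Real.mul_rpow (by positivity) (by positivity),
      ← Real.rpow_mul ht.le, ← Real.rpow_mul hs.le, ← Real.rpow_mul ht.le, ← Real.rpow_mul hs.le,
      mul_comm α, mul_comm (1 - α)]
end

section
/- Let f ∈ OM_+^1, let a ∈ [−1,1] with a ≠ 0, and let α ∈ (0,1). Then the following are equivalent: (I) f((α t^a + (1−α) s^a)^{1/a}) = (α f(t)^a + (1−α) f(s)^a)^{1/a} for all t, s > 0; (II) there exists β ∈ [0,1] such that f(t) = (β t^a + (1−β))^{1/a} for all t > 0. -/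
open Matrix Filter Set Topology
open scoped ComplexOrder

/-- A bounded function on `[0, 1]` that vanishes at the endpoints and respects one fixed proper
convex combination vanishes identically. -/
theorem eq_zero_of_convexComb_of_bounded {D : ℝ → ℝ} {α C : ℝ} (hα : α ∈ Set.Ioo (0 : ℝ) 1)
    (h0 : D 0 = 0) (h1 : D 1 = 0) (hC : ∀ l ∈ Set.Icc (0 : ℝ) 1, |D l| ≤ C)
    (hD : ∀ l ∈ Set.Icc (0 : ℝ) 1, ∀ m ∈ Set.Icc (0 : ℝ) 1,
      D (α * l + (1 - α) * m) = α * D l + (1 - α) * D m) :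
    ∀ l ∈ Set.Icc (0 : ℝ) 1, D l = 0 := by
  obtain ⟨hα0, hα1⟩ := hα
  have hα1' : 0 < 1 - α := sub_pos.2 hα1
  set q := max α (1 - α) with hq
  have hq0 : 0 ≤ q := hα0.le.trans (le_max_left _ _)
  have hq1 : q < 1 := max_lt hα1 (by linarith)
  have bound (n : ℕ) : ∀ l ∈ Set.Icc (0 : ℝ) 1, |D l| ≤ q ^ n * C := by
    induction n with
    | zero => simpa using hC
    | succ n ih =>
      rintro l ⟨hl0, hl1⟩
      rcases le_total l α with hl | hl
      · have hm : l / α ∈ Set.Icc (0 : ℝ) 1 := ⟨by positivity, (div_le_one hα0).2 hl⟩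
        have h := hD _ hm 0 (by simp)
        rw [mul_div_cancel₀ l hα0.ne', mul_zero, add_zero, h0, mul_zero, add_zero] at h
        rw [h, abs_mul, abs_of_pos hα0, pow_succ', mul_assoc]
        exact mul_le_mul (le_max_left _ _) (ih _ hm) (abs_nonneg _) hq0
      · have hm : (l - α) / (1 - α) ∈ Set.Icc (0 : ℝ) 1 :=
          ⟨div_nonneg (by linarith) hα1'.le, (div_le_one hα1').2 (by linarith)⟩
        have h := hD 1 (by simp) _ hm
        rw [mul_div_cancel₀ _ hα1'.ne', h1, mul_zero, zero_add, mul_one, add_sub_cancel] at h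
        rw [h, abs_mul, abs_of_pos hα1', pow_succ', mul_assoc]
        exact mul_le_mul (le_max_right _ _) (ih _ hm) (abs_nonneg _) hq0
  intro l hl
  have hlim : Tendsto (fun n : ℕ => q ^ n * C) atTop (𝓝 0) := by
    simpa using (tendsto_pow_atTop_nhds_zero_of_lt_one hq0 hq1).mul_const C
  exact abs_nonpos_iff.1 (ge_of_tendsto' hlim fun n => bound n l hl)

theorem MonotoneOn.affine_of_convexComb {g : ℝ → ℝ} {α : ℝ} (hg : MonotoneOn g (Set.Ioi 0))
    (hα : α ∈ Set.Ioo (0 : ℝ) 1)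
    (h : ∀ x y : ℝ, 0 < x → 0 < y → g (α * x + (1 - α) * y) = α * g x + (1 - α) * g y)
    {x y l : ℝ} (hx : 0 < x) (hxy : x ≤ y) (hl : l ∈ Set.Icc (0 : ℝ) 1) :
    g (l * y + (1 - l) * x) = l * g y + (1 - l) * g x := by
  have hy : 0 < y := hx.trans_le hxy
  have ge_left (m : ℝ) (hm : m ∈ Set.Icc (0 : ℝ) 1) : x ≤ m * y + (1 - m) * x := by
    nlinarith [hm.1]
  have le_right (m : ℝ) (hm : m ∈ Set.Icc (0 : ℝ) 1) : m * y + (1 - m) * x ≤ y := by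
    nlinarith [hm.2]
  have hgxy : g x ≤ g y := hg hx hy hxy
  refine sub_eq_zero.1 (eq_zero_of_convexComb_of_bounded
    (D := fun l => g (l * y + (1 - l) * x) - (l * g y + (1 - l) * g x))
    (C := g y - g x) hα (by simp) (by simp) ?_ ?_ l hl)
  · intro m hm
    have hpos := hx.trans_le (ge_left m hm)
    have h1 := hg hx hpos (ge_left m hm)
    have h2 := hg hpos hy (le_right m hm)
    rw [abs_le]
    constructor <;> nlinarith [hm.1, hm.2]
  · intro m hm k hk
    have e : (α * m + (1 - α) * k) * y + (1 - (α * m + (1 - α) * k)) * x =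
        α * (m * y + (1 - m) * x) + (1 - α) * (k * y + (1 - k) * x) := by ring
    simp only [e, h _ _ (hx.trans_le (ge_left m hm)) (hx.trans_le (ge_left k hk))]
    ring

theorem MonotoneOn.eq_affine_of_convexComb {g : ℝ → ℝ} {α : ℝ} (hg : MonotoneOn g (Set.Ioi 0))
    (hα : α ∈ Set.Ioo (0 : ℝ) 1)
    (h : ∀ x y : ℝ, 0 < x → 0 < y → g (α * x + (1 - α) * y) = α * g x + (1 - α) * g y)
    {x : ℝ} (hx : 0 < x) : g x = g 1 + (g 2 - g 1) * (x - 1) := by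
  have slope {u v w : ℝ} (hu : 0 < u) (huv : u ≤ v) (hvw : v ≤ w) (huw : u < w) :
      (w - u) * g v = (v - u) * g w + (w - v) * g u := by
    have hd : 0 < w - u := sub_pos.2 huw
    have key := hg.affine_of_convexComb hα h (l := (v - u) / (w - u)) hu huw.le
      ⟨div_nonneg (by linarith) hd.le, (div_le_one hd).2 (by linarith)⟩
    have e : (v - u) / (w - u) * w + (1 - (v - u) / (w - u)) * u = v := by
      field_simp
      ring
    rw [e] at key
    rw [key]
    field_simp
    ring
  rcases le_total x 1 with h1 | h1
  · linarith [slope hx h1 one_le_two (by linarith)]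
  · rcases le_total x 2 with h2 | h2
    · linarith [slope one_pos h1 h2 one_lt_two]
    · linarith [slope one_pos one_le_two h2 (by linarith)]

theorem monotoneOn_rpow_conj {f : ℝ → ℝ} (hf : MonotoneOn f (Set.Ioi 0))
    (hpos : ∀ t : ℝ, 0 < t → 0 < f t) (a : ℝ) :
    MonotoneOn (fun x => f (x ^ (1 / a)) ^ a) (Set.Ioi 0) := by
  intro x hx y hy hxy
  have hx' : 0 < x ^ (1 / a) := Real.rpow_pos_of_pos hx _
  have hy' : 0 < y ^ (1 / a) := Real.rpow_pos_of_pos hy _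
  rcases le_total 0 a with ha | ha
  · exact Real.rpow_le_rpow (hpos _ hx').le
      (hf hx' hy' (Real.rpow_le_rpow hx.le hxy (one_div_nonneg.2 ha))) ha
  · exact Real.rpow_le_rpow_of_nonpos (hpos _ hy')
      (hf hy' hx' (Real.rpow_le_rpow_of_nonpos hx hxy (one_div_nonpos.2 ha))) ha

theorem stmt_14 (f : ℝ → ℝ) (hf : OMone f) (a : ℝ) (ha : a ∈ Set.Icc (-1 : ℝ) 1) (ha0 : a ≠ 0)
    (α : ℝ) (hα : α ∈ Set.Ioo (0 : ℝ) 1) :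
    (∀ t s : ℝ, 0 < t → 0 < s →
        f ((α * t ^ a + (1 - α) * s ^ a) ^ (1 / a)) =
          (α * f t ^ a + (1 - α) * f s ^ a) ^ (1 / a)) ↔
      ∃ β ∈ Set.Icc (0 : ℝ) 1, ∀ t : ℝ, 0 < t → f t = (β * t ^ a + (1 - β)) ^ (1 / a) := by
  obtain ⟨hpos, hf1, hmono⟩ := hf
  have inv_left {x : ℝ} (hx : 0 < x) : (x ^ (1 / a)) ^ a = x := by
    rw [one_div, Real.rpow_inv_rpow hx.le ha0]
  have inv_right {x : ℝ} (hx : 0 < x) : (x ^ a) ^ (1 / a) = x := by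
    rw [one_div, Real.rpow_rpow_inv hx.le ha0]
  have comb_pos {u v : ℝ} (hu : 0 < u) (hv : 0 < v) : 0 < α * u + (1 - α) * v :=
    add_pos (mul_pos hα.1 hu) (mul_pos (sub_pos.2 hα.2) hv)
  constructor
  · intro h
    set g : ℝ → ℝ := fun x => f (x ^ (1 / a)) ^ a with hgdef
    have hg : MonotoneOn g (Set.Ioi 0) := monotoneOn_rpow_conj hmono.monotoneOn hpos a
    have hgpos (x : ℝ) (hx : 0 < x) : 0 < g x :=
      Real.rpow_pos_of_pos (hpos _ (Real.rpow_pos_of_pos hx _)) _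
    have hg1 : g 1 = 1 := by simp [hgdef, hf1]
    have hcomb (x y : ℝ) (hx : 0 < x) (hy : 0 < y) :
        g (α * x + (1 - α) * y) = α * g x + (1 - α) * g y := by
      have key := h _ _ (Real.rpow_pos_of_pos hx (1 / a)) (Real.rpow_pos_of_pos hy (1 / a))
      rw [inv_left hx, inv_left hy] at key
      change f _ ^ a = _
      rw [key]
      exact inv_left (comb_pos (hgpos x hx) (hgpos y hy))
    have haff {x : ℝ} (hx : 0 < x) := hg.eq_affine_of_convexComb hα hcomb hx
    rw [hg1] at haff
    refine ⟨g 2 - 1, ⟨?_, ?_⟩, fun t ht => ?_⟩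
    · have := hg (Set.mem_Ioi.2 one_pos) (Set.mem_Ioi.2 two_pos) one_le_two
      linarith
    · by_contra! hβ
      have hβ0 : 0 < g 2 - 1 := one_pos.trans hβ
      have hx : 0 < (g 2 - 1 - 1) / (g 2 - 1) := div_pos (by linarith) hβ0
      have hp := hgpos _ hx
      rw [haff hx, mul_sub, mul_div_cancel₀ _ hβ0.ne'] at hp
      linarith
    · have hta := Real.rpow_pos_of_pos ht a
      have e : (g 2 - 1) * t ^ a + (1 - (g 2 - 1)) = g (t ^ a) := by
        rw [haff hta]
        ring
      rw [e]
      simp only [hgdef, inv_right ht, inv_right (hpos t ht)]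
  · rintro ⟨β, ⟨hβ0, hβ1⟩, hβ⟩ t s ht hs
    have base_pos {x : ℝ} (hx : 0 < x) : 0 < β * x + (1 - β) := by
      rcases hβ0.eq_or_lt with rfl | hβ0
      · simp
      · exact add_pos_of_pos_of_nonneg (mul_pos hβ0 hx) (sub_nonneg.2 hβ1)
    have hta := Real.rpow_pos_of_pos ht a
    have hsa := Real.rpow_pos_of_pos hs a
    have hc := comb_pos hta hsa
    rw [hβ _ (Real.rpow_pos_of_pos hc _), hβ t ht, hβ s hs, inv_left hc,
      inv_left (base_pos hta), inv_left (base_pos hsa)]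
    congr 1
    ring
end

section
/- Let r ∈ (−1,1), α ∈ (0,1), f ∈ OM_+^1, and Φ = Φ_{(r,α)}. Then the following are equivalent: (I) f preserves σ_Φ; (II) f is trivial, i.e. f(t) = 1 for all t > 0 or f(t) = t for all t > 0. -/
open Matrix Filter Set Topology
open scoped ComplexOrder

noncomputable def powerRep (r a : ℝ) : ℝ → ℝ :=
  fun t => if r = 0 then t ^ a else (a * t ^ r + (1 - a)) ^ (1 / r)

section MatFun

variable {n : ℕ} {f g : ℝ → ℝ} {A B : Matrix (Fin n) (Fin n) ℂ}

lemma spectrum_pos_of_posDef (hA : A.PosDef) {x : ℝ} (hx : x ∈ spectrum ℝ A) : 0 < x := by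
  rw [hA.isHermitian.spectrum_real_eq_range_eigenvalues] at hx
  obtain ⟨i, rfl⟩ := hx
  exact hA.eigenvalues_pos i

lemma matFun_isHermitian (f : ℝ → ℝ) (A : Matrix (Fin n) (Fin n) ℂ) :
    (matFun f A).IsHermitian :=
  cfc_predicate f A

lemma matFun_congr (hA : A.PosDef) (h : ∀ x, 0 < x → f x = g x) : matFun f A = matFun g A :=
  cfc_congr fun x hx => h x (spectrum_pos_of_posDef hA hx)

lemma matFun_mul (f g : ℝ → ℝ) (A : Matrix (Fin n) (Fin n) ℂ) :
    matFun f A * matFun g A = matFun (fun x => f x * g x) A :=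
  (cfc_mul f g A (A.finite_real_spectrum.continuousOn f)
    (A.finite_real_spectrum.continuousOn g)).symm

lemma matFun_comp (g f : ℝ → ℝ) (hA : A.IsHermitian) :
    matFun g (matFun f A) = matFun (fun x => g (f x)) A :=
  (cfc_comp' g f A ((A.finite_real_spectrum.image f).continuousOn g)
    (A.finite_real_spectrum.continuousOn f) hA).symm

lemma matFun_eq_one (hA : A.PosDef) (h : ∀ x, 0 < x → f x = 1) : matFun f A = 1 := by
  rw [matFun_congr (g := fun _ => 1) hA h]
  exact cfc_const_one ℝ A (ha := hA.isHermitian)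

lemma matFun_eq_self (hA : A.PosDef) (h : ∀ x, 0 < x → f x = x) : matFun f A = A := by
  rw [matFun_congr (g := fun x => x) hA h]
  exact cfc_id' ℝ A hA.isHermitian

lemma matFun_algebraMap (f : ℝ → ℝ) (a : ℝ) :
    matFun f (algebraMap ℝ (Matrix (Fin n) (Fin n) ℂ) a) = algebraMap ℝ _ (f a) :=
  cfc_algebraMap (p := IsSelfAdjoint) a f

lemma posDef_of_spectrum_pos (hA : A.IsHermitian) (h : ∀ x ∈ spectrum ℝ A, 0 < x) : A.PosDef :=
  hA.posDef_iff_eigenvalues_pos.mpr fun i => h _ (hA.eigenvalues_mem_spectrum_real i)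

lemma matFun_posDef (hA : A.PosDef) (h : ∀ x, 0 < x → 0 < f x) : (matFun f A).PosDef := by
  refine posDef_of_spectrum_pos (matFun_isHermitian f A) fun x hx => ?_
  obtain ⟨y, hy, rfl⟩ := (cfc_map_spectrum f A hA.isHermitian
    (A.finite_real_spectrum.continuousOn f)).subset hx
  exact h y (spectrum_pos_of_posDef hA hy)

lemma posDef_algebraMap {a : ℝ} (ha : 0 < a) :
    (algebraMap ℝ (Matrix (Fin n) (Fin n) ℂ) a).PosDef := by
  have : matFun (fun _ => a) (1 : Matrix (Fin n) (Fin n) ℂ) = algebraMap ℝ _ a :=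
    cfc_const a 1 (.one _)
  exact this ▸ matFun_posDef .one fun _ _ => ha

lemma posDef_sandwich (hB : B.PosDef) (hA : A.PosDef) : (A * B * A).PosDef := by
  have := hB.conjTranspose_mul_mul_same (Matrix.mulVec_injective_iff_isUnit.mpr hA.isUnit)
  rwa [hA.isHermitian.eq] at this

lemma matFun_sqrt_posDef (hA : A.PosDef) : (matFun Real.sqrt A).PosDef :=
  matFun_posDef hA fun _ => Real.sqrt_pos.mpr

lemma matFun_inv_sqrt_posDef (hA : A.PosDef) : (matFun (fun x => (Real.sqrt x)⁻¹) A).PosDef :=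
  matFun_posDef hA fun _ hx => inv_pos.mpr (Real.sqrt_pos.mpr hx)

lemma matFun_sqrt_mul_inv_sqrt (hA : A.PosDef) :
    matFun Real.sqrt A * matFun (fun x => (Real.sqrt x)⁻¹) A = 1 := by
  rw [matFun_mul]
  exact matFun_eq_one hA fun x hx => mul_inv_cancel₀ (Real.sqrt_pos.mpr hx).ne'

lemma matFun_inv_sqrt_mul_sqrt (hA : A.PosDef) :
    matFun (fun x => (Real.sqrt x)⁻¹) A * matFun Real.sqrt A = 1 := by
  rw [matFun_mul]
  exact matFun_eq_one hA fun x hx => inv_mul_cancel₀ (Real.sqrt_pos.mpr hx).ne'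

lemma kuboMean_congr {Φ Ψ : ℝ → ℝ} (hA : A.PosDef) (hB : B.PosDef)
    (h : ∀ x, 0 < x → Φ x = Ψ x) : kuboMean Φ A B = kuboMean Ψ A B := by
  rw [kuboMean, kuboMean, matFun_congr (posDef_sandwich hB (matFun_inv_sqrt_posDef hA)) h]

lemma kuboMean_posDef {Φ : ℝ → ℝ} (hΦ : ∀ x, 0 < x → 0 < Φ x) (hA : A.PosDef)
    (hB : B.PosDef) : (kuboMean Φ A B).PosDef :=
  posDef_sandwich (matFun_posDef (posDef_sandwich hB (matFun_inv_sqrt_posDef hA)) hΦ)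
    (matFun_sqrt_posDef hA)

lemma kuboMean_one_one {Φ : ℝ → ℝ} (hΦ : Φ 1 = 1) :
    kuboMean Φ (1 : Matrix (Fin n) (Fin n) ℂ) 1 = 1 := by
  have h (g : ℝ → ℝ) (hg : g 1 = 1) : matFun g (1 : Matrix (Fin n) (Fin n) ℂ) = 1 := by
    simpa [hg] using matFun_algebraMap (n := n) g 1
  simp [kuboMean, h, hΦ]

lemma matFun_inv (hA : A.PosDef) : matFun (fun x => x⁻¹) A = A⁻¹ := by
  refine (Matrix.inv_eq_right_inv ?_).symm
  nth_rewrite 1 [← matFun_eq_self (f := fun x => x) hA fun _ _ => rfl]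
  rw [matFun_mul]
  exact matFun_eq_one hA fun x hx => mul_inv_cancel₀ hx.ne'

lemma matFun_adjFun (hA : A.PosDef) (hf : ∀ x, 0 < x → 0 < f x) :
    matFun (adjFun f) A = (matFun f A⁻¹)⁻¹ := by
  refine (Matrix.inv_eq_right_inv ?_).symm
  rw [← matFun_inv hA, matFun_comp _ _ hA.isHermitian, matFun_mul]
  exact matFun_eq_one hA fun x hx => mul_inv_cancel₀ (hf _ (inv_pos.mpr hx)).ne'

lemma kuboMean_adjFun {Φ : ℝ → ℝ} (hΦ : ∀ x, 0 < x → 0 < Φ x) (hA : A.PosDef) (hB : B.PosDef) :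
    kuboMean (adjFun Φ) A B = (kuboMean Φ A⁻¹ B⁻¹)⁻¹ := by
  have hsqrt : matFun Real.sqrt A⁻¹ = (matFun Real.sqrt A)⁻¹ := by
    rw [Matrix.inv_eq_right_inv (matFun_sqrt_mul_inv_sqrt hA), ← matFun_inv hA,
      matFun_comp _ _ hA.isHermitian]
    exact matFun_congr hA fun x _ => Real.sqrt_inv x
  have hinv : matFun (fun x => (Real.sqrt x)⁻¹) A⁻¹ = matFun Real.sqrt A := by
    rw [← matFun_inv hA, matFun_comp _ _ hA.isHermitian]
    exact matFun_congr hA fun x _ => by rw [Real.sqrt_inv, inv_inv]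
  have hinv' : matFun (fun x => (Real.sqrt x)⁻¹) A = (matFun Real.sqrt A)⁻¹ :=
    (Matrix.inv_eq_right_inv (matFun_sqrt_mul_inv_sqrt hA)).symm
  have hunit : IsUnit (matFun Real.sqrt A).det :=
    (Matrix.isUnit_iff_isUnit_det _).mp (matFun_sqrt_posDef hA).isUnit
  rw [kuboMean, kuboMean, matFun_adjFun (posDef_sandwich hB (matFun_inv_sqrt_posDef hA)) hΦ,
    hsqrt, hinv, hinv']
  simp only [Matrix.mul_inv_rev, Matrix.nonsing_inv_nonsing_inv _ hunit, Matrix.mul_assoc]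

lemma preservesMean_adjFun {Φ f : ℝ → ℝ} (hΦ : ∀ x, 0 < x → 0 < Φ x)
    (hf : ∀ x, 0 < x → 0 < f x) (h : PreservesMean Φ f) :
    PreservesMean (adjFun Φ) (adjFun f) := by
  intro n A B hA hB
  have hAf := matFun_posDef hA.inv hf
  have hBf := matFun_posDef hB.inv hf
  have hK := kuboMean_posDef hΦ hA.inv hB.inv
  rw [kuboMean_adjFun hΦ hA hB, matFun_adjFun hK.inv hf, matFun_adjFun hA hf,
    matFun_adjFun hB hf, kuboMean_adjFun hΦ hAf.inv hBf.inv]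
  have h1 {C : Matrix (Fin n) (Fin n) ℂ} (hC : C.PosDef) : C⁻¹⁻¹ = C :=
    Matrix.nonsing_inv_nonsing_inv _ ((Matrix.isUnit_iff_isUnit_det _).mp hC.isUnit)
  rw [h1 hK, h1 hAf, h1 hBf, h n _ _ hA.inv hB.inv]

/-- The scalar form of preservation of the mean `a Φ(b / a)`. -/
lemma preservesMean_scalar {Φ f : ℝ → ℝ} (hf : ∀ x, 0 < x → 0 < f x) (h : PreservesMean Φ f)
    {a b : ℝ} (ha : 0 < a) (hb : 0 < b) :
    f (a * Φ (b / a)) = f a * Φ (f b / f a) := by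
  have key {a b : ℝ} (ha : 0 < a) :
      kuboMean Φ (algebraMap ℝ (Matrix (Fin 1) (Fin 1) ℂ) a) (algebraMap ℝ _ b) =
        algebraMap ℝ _ (a * Φ (b / a)) := by
    have hs : √a ≠ 0 := (Real.sqrt_pos.mpr ha).ne'
    have e1 : (√a)⁻¹ * b * (√a)⁻¹ = b / a := by
      rw [mul_right_comm, ← mul_inv, Real.mul_self_sqrt ha.le, div_eq_inv_mul]
    rw [kuboMean, matFun_algebraMap, matFun_algebraMap, ← map_mul, ← map_mul, e1,
      matFun_algebraMap, ← map_mul, ← map_mul, mul_right_comm, Real.mul_self_sqrt ha.le]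
  have := h 1 _ _ (posDef_algebraMap ha) (posDef_algebraMap hb)
  rw [key ha, matFun_algebraMap, matFun_algebraMap, matFun_algebraMap, key (hf a ha)] at this
  exact (algebraMap ℝ (Matrix (Fin 1) (Fin 1) ℂ)).injective this

lemma monotoneOn_of_opMonotone {f : ℝ → ℝ} (hf : OpMonotone f) : MonotoneOn f (Ioi 0) := by
  intro a ha b hb hab
  have hsub (c d : ℝ) : loewnerLE (algebraMap ℝ (Matrix (Fin 1) (Fin 1) ℂ) c)
      (algebraMap ℝ _ d) ↔ c ≤ d := by
    rw [loewnerLE, ← map_sub, Algebra.algebraMap_eq_smul_one, ← Matrix.diagonal_one]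
    rw [← Matrix.diagonal_smul, Matrix.posSemidef_diagonal_iff]
    simp
  have := hf 1 _ _ (posDef_algebraMap ha) (posDef_algebraMap hb) ((hsub a b).mpr hab)
  rwa [matFun_algebraMap, matFun_algebraMap, hsub] at this

lemma preservesMean_of_trivial {Φ f : ℝ → ℝ} (hΦ : ∀ x, 0 < x → 0 < Φ x) (hΦ1 : Φ 1 = 1)
    (hf : OMTrivial f) : PreservesMean Φ f := by
  intro n A B hA hB
  rcases hf with hf | hf
  · rw [matFun_eq_one hA hf, matFun_eq_one hB hf, matFun_eq_one (kuboMean_posDef hΦ hA hB) hf,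
      kuboMean_one_one hΦ1]
  · rw [matFun_eq_self hA hf, matFun_eq_self hB hf, matFun_eq_self (kuboMean_posDef hΦ hA hB) hf]

end MatFun

section MatrixLimit

variable {n : ℕ} {f g Φ : ℝ → ℝ} {A B : Matrix (Fin n) (Fin n) ℂ}

lemma matFun_diagonal (g : ℝ → ℝ) (a : Fin n → ℝ) :
    matFun g (Matrix.diagonal fun i => (a i : ℂ)) = Matrix.diagonal fun i => (g (a i) : ℂ) := by
  set A : Matrix (Fin n) (Fin n) ℂ := Matrix.diagonal fun i => (a i : ℂ) with hA
  have hAh : IsSelfAdjoint A := by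
    rw [hA]
    exact Matrix.isHermitian_diagonal_of_self_adjoint _ (by ext i; simp)
  let S : Finset ℝ := A.finite_real_spectrum.toFinset ∪ Finset.univ.image a
  let p : Polynomial ℝ := Lagrange.interpolate S id g
  have hp (x : ℝ) (hx : x ∈ S) : p.eval x = g x :=
    Lagrange.eval_interpolate_at_node (v := id) g (Function.injective_id.injOn) hx
  have h1 : matFun g A = cfc p.eval A :=
    cfc_congr fun x hx => (hp x (Finset.mem_union_left _ (by simpa using hx))).symm
  rw [h1, cfc_polynomial p A hAh]
  have h2 := Polynomial.aeval_algHom_apply (Matrix.diagonalAlgHom (n := Fin n) (α := ℂ) ℝ)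
    (fun i => (a i : ℂ)) p
  rw [Matrix.diagonalAlgHom_apply, Matrix.diagonalAlgHom_apply] at h2
  rw [hA, h2]
  congr 1
  ext i
  have h3 := Polynomial.aeval_algHom_apply (Pi.evalAlgHom ℝ (fun _ : Fin n => ℂ) i)
    (fun i => (a i : ℂ)) p
  rw [Pi.evalAlgHom_apply, Pi.evalAlgHom_apply] at h3
  rw [← hp (a i) (Finset.mem_union_right _ (by simp)), ← h3]
  exact Polynomial.aeval_algebraMap_apply_eq_algebraMap_eval (A := ℂ) (a i) p

open scoped Matrix.Norms.L2Operator in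
lemma continuous_matFun {X : ℝ → Matrix (Fin n) (Fin n) ℂ} (hg : Continuous g)
    (hX : Continuous X) (hXh : ∀ ε, (X ε).IsHermitian) : Continuous fun ε => matFun g (X ε) := by
  refine Continuous.cfc (s := fun ε =>
    Metric.closedBall 0 ((‖X ε‖ + 1) * ‖(1 : Matrix (Fin n) (Fin n) ℂ)‖)) g hX
      (fun _ => isCompact_closedBall _ _) (fun ε₀ => ?_) (fun _ => hg.continuousOn) hXh
  have : ∀ᶠ ε in 𝓝 ε₀, ‖X ε‖ < ‖X ε₀‖ + 1 := hX.norm.continuousAt.eventually_lt_const (by simp)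
  filter_upwards [this] with ε hε
  refine (spectrum.subset_closedBall_norm_mul (𝕜 := ℝ) (X ε)).trans
    (Metric.closedBall_subset_closedBall ?_)
  gcongr

lemma matFun_smul_projection {Q : Matrix (Fin n) (Fin n) ℂ} (hQ : Q * Q = Q)
    (hQh : Q.IsHermitian) (hg : g 0 = 0) (c : ℝ) : matFun g (c • Q) = g c • Q := by
  have h1 : matFun (fun x => c * x) Q = c • Q := cfc_const_mul_id c Q hQh
  have h2 : matFun (fun x => g c * x) Q = g c • Q := cfc_const_mul_id (g c) Q hQh
  rw [← h1, matFun_comp _ _ hQh, ← h2]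
  refine cfc_congr fun x hx => ?_
  rcases IsIdempotentElem.spectrum_subset ℝ hQ hx with rfl | rfl <;> simp [hg]

lemma mean_with_projection {P D E : Matrix (Fin n) (Fin n) ℂ} {s : ℝ}
    (hPh : P.IsHermitian) (hD : D.IsHermitian) (hDE : D * E = 1) (hED : E * D = 1)
    (hs : 0 < s) (hPDP : P * (D * D) * P = s • P) (hg : g 0 = 0) (t : ℝ) :
    E * matFun g (D * (t • P) * D) * E = (g (t * s) / s) • P := by
  set Q := s⁻¹ • (D * P * D) with hQdef
  have hQ : Q * Q = Q := by
    have : D * P * D * (D * P * D) = s • (D * P * D) := by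
      calc D * P * D * (D * P * D) = D * (P * (D * D) * P) * D := by
            simp only [Matrix.mul_assoc]
        _ = _ := by rw [hPDP]; simp
    rw [hQdef, Matrix.smul_mul, Matrix.mul_smul, this, smul_smul, smul_smul, mul_assoc,
      inv_mul_cancel₀ hs.ne', mul_one]
  have hQh : Q.IsHermitian := by
    have : (D * P * D).IsHermitian := by
      simpa [hD.eq] using Matrix.isHermitian_conjTranspose_mul_mul D hPh
    rw [Matrix.IsHermitian, hQdef, Matrix.conjTranspose_smul, this.eq, star_trivial]
  have h1 : D * (t • P) * D = (t * s) • Q := by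
    rw [hQdef, smul_smul, mul_assoc t, mul_inv_cancel₀ hs.ne', mul_one]
    simp
  rw [h1, matFun_smul_projection hQ hQh hg, hQdef, smul_smul, ← div_eq_mul_inv]
  calc E * ((g (t * s) / s) • (D * P * D)) * E = (g (t * s) / s) • (E * D * P * (D * E)) := by
        simp [Matrix.mul_assoc]
    _ = _ := by simp [hDE, hED]

/-- The extension by zero of a function on the positive half-line. -/
noncomputable def extendZero (f : ℝ → ℝ) : ℝ → ℝ := fun x => if 0 < x then f x else 0

lemma extendZero_of_pos {x : ℝ} (hx : 0 < x) : extendZero f x = f x := if_pos hx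

lemma extendZero_zero : extendZero f 0 = 0 := if_neg (lt_irrefl 0)

lemma continuous_extendZero (hf : ContinuousOn f (Ioi 0))
    (hf0 : Tendsto f (𝓝[>] 0) (𝓝 0)) : Continuous (extendZero f) := by
  rw [continuous_iff_continuousAt]
  intro x
  rcases lt_trichotomy x 0 with hx | rfl | hx
  · refine (continuousAt_const (y := (0 : ℝ))).congr ?_
    filter_upwards [Iio_mem_nhds hx] with y hy
    exact (if_neg (not_lt.mpr (le_of_lt hy))).symm
  · rw [continuousAt_iff_continuous_left'_right']
    constructor
    · rw [ContinuousWithinAt, extendZero_zero]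
      refine tendsto_const_nhds.congr' ?_
      filter_upwards [self_mem_nhdsWithin] with y hy
      exact (if_neg (not_lt.mpr (le_of_lt hy))).symm
    · rw [ContinuousWithinAt, extendZero_zero]
      refine hf0.congr' ?_
      filter_upwards [self_mem_nhdsWithin] with y hy
      exact (if_pos hy).symm
  · refine (hf.continuousAt (Ioi_mem_nhds hx)).congr ?_
    filter_upwards [Ioi_mem_nhds hx] with y hy
    exact (if_pos hy).symm

/-- Preservation of a mean extends by continuity to a positive semidefinite second argument. -/
lemma preservesMean_extendZero (h : PreservesMean Φ f) (hΦ : ∀ x, 0 < x → 0 < Φ x)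
    (hf : ∀ x, 0 < x → 0 < f x) (hΦc : Continuous (extendZero Φ))
    (hfc : Continuous (extendZero f)) (hA : A.PosDef) (hB : B.PosSemidef) :
    matFun (extendZero f) (kuboMean (extendZero Φ) A B) =
      kuboMean (extendZero Φ) (matFun f A) (matFun (extendZero f) B) := by
  let X : ℝ → Matrix (Fin n) (Fin n) ℂ := fun ε => B + algebraMap ℝ _ ε
  have hXc : Continuous X := by
    simp only [X, Algebra.algebraMap_eq_smul_one]
    fun_prop
  have hXh (ε : ℝ) : (X ε).IsHermitian :=
    hB.isHermitian.add (cfc_predicate_algebraMap (p := IsSelfAdjoint) ε)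
  have hsand (C D : Matrix (Fin n) (Fin n) ℂ) (hC : C.IsHermitian) (hD : D.IsHermitian) :
      (D * C * D).IsHermitian := by
    simpa [hD.eq] using Matrix.isHermitian_conjTranspose_mul_mul D hC
  have hkc (C : Matrix (Fin n) (Fin n) ℂ) {Y : ℝ → Matrix (Fin n) (Fin n) ℂ}
      (hY : Continuous Y) (hYh : ∀ ε, (Y ε).IsHermitian) :
      Continuous fun ε => kuboMean (extendZero Φ) C (Y ε) := by
    have : Continuous fun ε => matFun (extendZero Φ)
        (matFun (fun x => (Real.sqrt x)⁻¹) C * Y ε * matFun (fun x => (Real.sqrt x)⁻¹) C) :=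
      continuous_matFun hΦc (by fun_prop) fun ε => hsand _ _ (hYh ε) (matFun_isHermitian _ _)
    unfold kuboMean
    fun_prop
  have hL : Continuous fun ε =>
      matFun (extendZero f) (kuboMean (extendZero Φ) A (X ε)) :=
    continuous_matFun hfc (hkc A hXc hXh) fun ε =>
      hsand _ _ (matFun_isHermitian _ _) (matFun_isHermitian _ _)
  have hR : Continuous fun ε => kuboMean (extendZero Φ) (matFun f A)
      (matFun (extendZero f) (X ε)) :=
    hkc _ (continuous_matFun hfc hXc hXh) fun ε => matFun_isHermitian _ _
  have heq : ∀ᶠ ε in 𝓝[>] (0 : ℝ),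
      matFun (extendZero f) (kuboMean (extendZero Φ) A (X ε)) =
      kuboMean (extendZero Φ) (matFun f A) (matFun (extendZero f) (X ε)) := by
    filter_upwards [self_mem_nhdsWithin] with ε hε
    have hXp : (X ε).PosDef := (posDef_algebraMap hε).posSemidef_add hB
    have e (g : ℝ → ℝ) (x : ℝ) (hx : 0 < x) : extendZero g x = g x := extendZero_of_pos hx
    rw [kuboMean_congr hA hXp (e Φ), matFun_congr (kuboMean_posDef hΦ hA hXp) (e f),
      matFun_congr hXp (e f), kuboMean_congr (matFun_posDef hA hf) (matFun_posDef hXp hf) (e Φ)]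
    exact h n A _ hA hXp
  have := tendsto_nhds_unique_of_eventuallyEq (hL.continuousWithinAt (x := 0) (s := Ioi 0))
    hR.continuousWithinAt heq
  simpa [X] using this

/-- Applying a preserved mean to a scalar multiple of a rank-one projection shows that the
reciprocal `x ↦ (f x⁻¹)⁻¹` is affine. -/
lemma adjFun_affine_of_preservesMean (h : PreservesMean Φ f) (hΦ : ∀ x, 0 < x → 0 < Φ x)
    (hΦ1 : ∀ x, 0 < x → (Φ x = x ↔ x = 1)) (hf : ∀ x, 0 < x → 0 < f x)
    (hΦc : Continuous (extendZero Φ)) (hfc : Continuous (extendZero f)) {x y l : ℝ}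
    (hx : 0 < x) (hy : 0 < y) (hl : l ∈ Ioo (0 : ℝ) 1) :
    adjFun f (l * x + (1 - l) * y) = l * adjFun f x + (1 - l) * adjFun f y := by
  obtain ⟨hl0, hl1⟩ := hl
  have hl1' : 0 < 1 - l := sub_pos.mpr hl1
  set m := √(l * (1 - l))
  have hm : (m : ℂ) * m = l * (1 - l) := by
    exact_mod_cast Real.mul_self_sqrt (mul_pos hl0 hl1').le
  let P : Matrix (Fin 2) (Fin 2) ℂ := !![(l : ℂ), m; m, 1 - l]
  have hP : P * P = P := by
    ext i j
    fin_cases i <;> fin_cases j <;> simp [P, Matrix.mul_apply, Fin.sum_univ_two]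
    · linear_combination hm
    · ring
    · ring
    · linear_combination hm
  have hPh : P.IsHermitian := by
    ext i j
    fin_cases i <;> fin_cases j <;> simp [P]
  have hPD (u v : ℝ) : P * Matrix.diagonal (fun i => ((![u, v] i : ℝ) : ℂ)) * P =
      (l * u + (1 - l) * v) • P := by
    have hd : Matrix.diagonal (fun i => ((![u, v] i : ℝ) : ℂ)) = !![(u : ℂ), 0; 0, (v : ℂ)] := by
      ext i j
      fin_cases i <;> fin_cases j <;> simp
    rw [hd]
    ext i j
    fin_cases i <;> fin_cases j <;> simp [P, Matrix.mul_apply, Fin.sum_univ_two]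
    · linear_combination v * hm
    · ring
    · ring
    · linear_combination u * hm
  let A : Matrix (Fin 2) (Fin 2) ℂ := Matrix.diagonal fun i => ((![x⁻¹, y⁻¹] i : ℝ) : ℂ)
  have hA : A.PosDef := by
    rw [Matrix.posDef_diagonal_iff]
    intro i
    fin_cases i <;> simp [hx, hy]
  have hPA (g : ℝ → ℝ) : P * matFun g A * P = (l * g x⁻¹ + (1 - l) * g y⁻¹) • P := by
    rw [matFun_diagonal, ← hPD]
    congr 3
    ext i
    fin_cases i <;> rfl
  have hmean {C : Matrix (Fin 2) (Fin 2) ℂ} {s : ℝ} (t : ℝ) (hC : C.PosDef) (hs : 0 < s)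
      (hPC : P * matFun (fun x => x⁻¹) C * P = s • P) :
      kuboMean (extendZero Φ) C (t • P) = (extendZero Φ (t * s) / s) • P := by
    refine mean_with_projection hPh (matFun_isHermitian _ _) (matFun_inv_sqrt_mul_sqrt hC)
      (matFun_sqrt_mul_inv_sqrt hC) hs ?_ extendZero_zero t
    rw [matFun_mul, ← hPC]
    congr 2
    exact matFun_congr hC fun x hx => by rw [← mul_inv, Real.mul_self_sqrt hx.le]
  set s := l * x + (1 - l) * y with hs_def
  have hs : 0 < s := by positivity
  have hadj (z : ℝ) (hz : 0 < z) : 0 < adjFun f z := inv_pos.mpr (hf _ (inv_pos.mpr hz))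
  set s' := l * adjFun f x + (1 - l) * adjFun f y with hs'_def
  have hs' : 0 < s' := add_pos (mul_pos hl0 (hadj x hx)) (mul_pos hl1' (hadj y hy))
  have hBp : (s⁻¹ • P).PosSemidef := by
    have : P.PosSemidef := by
      simpa [hPh.eq, hP] using Matrix.posSemidef_conjTranspose_mul_self P
    exact this.smul (inv_pos.mpr hs).le
  have key := preservesMean_extendZero h hΦ hf hΦc hfc hA hBp
  have hPA' : P * matFun (fun x => x⁻¹) (matFun f A) * P = s' • P := by
    rw [matFun_comp _ _ hA.isHermitian, hPA]
    rfl
  have hs1 : 0 < s⁻¹ := inv_pos.mpr hs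
  have hfs := hf _ hs1
  rw [hmean _ hA hs (by rw [hPA]; simp [s]), matFun_smul_projection hP hPh extendZero_zero,
    matFun_smul_projection hP hPh extendZero_zero, hmean _ (matFun_posDef hA hf) hs' hPA',
    inv_mul_cancel₀ hs.ne', extendZero_of_pos one_pos, (hΦ1 1 one_pos).mpr rfl, one_div,
    extendZero_of_pos hs1, extendZero_of_pos (mul_pos hfs hs')] at key
  have h00 := congrFun (congrFun key 0) 0
  simp only [P, Matrix.smul_apply, Matrix.of_apply, Matrix.cons_val', Matrix.cons_val_zero,
    Complex.real_smul] at h00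
  have h1 : f s⁻¹ = Φ (f s⁻¹ * s') / s' := by
    exact_mod_cast mul_right_cancel₀ (Complex.ofReal_ne_zero.mpr hl0.ne') h00
  rw [eq_div_iff hs'.ne', eq_comm, hΦ1 _ (mul_pos hfs hs')] at h1
  exact inv_eq_of_mul_eq_one_right h1

end MatrixLimit

section Scalar

variable {f Φ : ℝ → ℝ}

/-- The properties of a power mean of order `r ≤ 0` used to regularize a function preserving it. -/
structure StrictMeanRep (Φ : ℝ → ℝ) : Prop where
  pos : ∀ x, 0 < x → 0 < Φ x
  continuousOn : ContinuousOn Φ (Ioi 0)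
  tendsto_zero : Tendsto Φ (𝓝[>] 0) (𝓝 0)
  map_one : Φ 1 = 1
  one_lt : ∀ x, 1 < x → 1 < Φ x
  lt_self : ∀ x, 1 < x → Φ x < x
  self_lt : ∀ x, 0 < x → x < 1 → x < Φ x

lemma StrictMeanRep.eq_self_iff (hΦ : StrictMeanRep Φ) (x : ℝ) (hx : 0 < x) :
    Φ x = x ↔ x = 1 := by
  refine ⟨fun h => ?_, fun h => h ▸ hΦ.map_one⟩
  rcases lt_trichotomy x 1 with h1 | h1 | h1
  · exact absurd h (hΦ.self_lt x hx h1).ne'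
  · exact h1
  · exact absurd h (hΦ.lt_self x h1).ne

lemma continuousOn_of_scalar_mean (hΦ : StrictMeanRep Φ) (hf : ∀ x, 0 < x → 0 < f x)
    (hmono : MonotoneOn f (Ioi 0))
    (h : ∀ a b, 0 < a → 0 < b → f (a * Φ (b / a)) = f a * Φ (f b / f a)) :
    ContinuousOn f (Ioi 0) := by
  intro x (hx : 0 < x)
  refine ContinuousAt.continuousWithinAt ?_
  have hIoo : MonotoneOn f (Ioo 0 x) := hmono.mono fun y hy => hy.1
  have hIoi : MonotoneOn f (Ioi x) := hmono.mono fun y (hy : x < y) => hx.trans hy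
  have hleft := hIoo.tendsto_nhdsWithin_Ioo_left (nonempty_Ioo.mpr hx)
    ⟨f x, by rintro _ ⟨y, hy, rfl⟩; exact hmono hy.1 hx hy.2.le⟩
  have hright := hIoi.tendsto_nhdsGT
    ⟨f x, by rintro _ ⟨y, hy, rfl⟩; exact hmono hx (hx.trans hy) (le_of_lt hy)⟩
  set l := sSup (f '' Ioo 0 x)
  set m := sInf (f '' Ioi x)
  have hnear : ∀ᶠ a in 𝓝[<] x, a ∈ Ioo 0 x := Ioo_mem_nhdsLT hx
  have hl_le : l ≤ f x := le_of_tendsto hleft <| by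
    filter_upwards [hnear] with a ha using hmono ha.1 hx ha.2.le
  have hm_le {y : ℝ} (hy : x < y) : m ≤ f y :=
    csInf_le ⟨f x, by rintro _ ⟨z, hz, rfl⟩; exact hmono hx (hx.trans hz) (le_of_lt hz)⟩
      (mem_image_of_mem f hy)
  have hle_m : f x ≤ m := ge_of_tendsto hright <| by
    filter_upwards [self_mem_nhdsWithin] with b hb
    exact hmono hx (hx.trans hb) (le_of_lt hb)
  have hl0 : 0 < l := by
    have hx2 : 0 < x / 2 := half_pos hx
    refine (hf _ hx2).trans_le (ge_of_tendsto hleft ?_)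
    filter_upwards [Ioo_mem_nhdsLT (half_lt_self hx)] with a ha
    exact hmono hx2 (hx2.trans ha.1) ha.1.le
  have hm0 : 0 < m := (hf x hx).trans_le hle_m
  have step1 (b : ℝ) (hb : x < b) : m ≤ l * Φ (f b / l) := by
    have hb0 := hx.trans hb
    have h1 : Tendsto (fun a => a * Φ (b / a)) (𝓝[<] x) (𝓝 (x * Φ (b / x))) := by
      have : Tendsto (fun a => b / a) (𝓝[<] x) (𝓝 (b / x)) :=
        (tendsto_const_nhds.div tendsto_id hx.ne').mono_left nhdsWithin_le_nhds
      exact (tendsto_id.mono_left nhdsWithin_le_nhds).mul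
        ((hΦ.continuousOn.continuousAt (Ioi_mem_nhds (div_pos hb0 hx))).tendsto.comp this)
    have h2 : x < x * Φ (b / x) :=
      lt_mul_of_one_lt_right hx (hΦ.one_lt _ ((one_lt_div hx).mpr hb))
    have h3 : Tendsto (fun a => f a * Φ (f b / f a)) (𝓝[<] x) (𝓝 (l * Φ (f b / l))) :=
      hleft.mul ((hΦ.continuousOn.continuousAt
        (Ioi_mem_nhds (div_pos (hf b hb0) hl0))).tendsto.comp
          (tendsto_const_nhds.div hleft hl0.ne'))
    refine ge_of_tendsto h3 ?_
    filter_upwards [hnear, h1.eventually_const_lt h2] with a ha ha'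
    rw [← h a b ha.1 hb0]
    exact hm_le ha'
  have step2 : m ≤ l * Φ (m / l) := by
    have h4 : Tendsto (fun b => l * Φ (f b / l)) (𝓝[>] x) (𝓝 (l * Φ (m / l))) :=
      tendsto_const_nhds.mul ((hΦ.continuousOn.continuousAt
        (Ioi_mem_nhds (div_pos hm0 hl0))).tendsto.comp (hright.div_const l))
    exact ge_of_tendsto h4 (Filter.eventually_of_mem self_mem_nhdsWithin step1)
  have hml : m ≤ l := by
    by_contra! hlt
    have := hΦ.lt_self _ ((one_lt_div hl0).mpr hlt)
    rw [lt_div_iff₀ hl0] at this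
    linarith
  rw [continuousAt_iff_continuous_left'_right']
  constructor
  · rwa [ContinuousWithinAt, le_antisymm (hle_m.trans hml) hl_le]
  · rwa [ContinuousWithinAt, le_antisymm hle_m (hml.trans hl_le)]

lemma eq_one_or_tendsto_zero (hΦ : StrictMeanRep Φ) (hf : ∀ x, 0 < x → 0 < f x)
    (hf1 : f 1 = 1) (hmono : MonotoneOn f (Ioi 0))
    (h : ∀ a b, 0 < a → 0 < b → f (a * Φ (b / a)) = f a * Φ (f b / f a)) :
    (∀ x, 0 < x → f x = 1) ∨ Tendsto f (𝓝[>] 0) (𝓝 0) := by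
  have hlim := hmono.tendsto_nhdsGT ⟨0, by rintro _ ⟨y, hy, rfl⟩; exact (hf y hy).le⟩
  set l := sInf (f '' Ioi 0)
  have hl : 0 ≤ l := ge_of_tendsto hlim <| by
    filter_upwards [self_mem_nhdsWithin] with y hy using (hf y hy).le
  rcases hl.eq_or_lt with hl | hl
  · exact Or.inr (hl ▸ hlim)
  left
  have hconst (a : ℝ) (ha : 0 < a) : f a = l := by
    have h1 : Tendsto (fun b => b / a) (𝓝[>] 0) (𝓝[>] 0) := by
      refine tendsto_nhdsWithin_iff.mpr ⟨?_, ?_⟩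
      · simpa using (tendsto_id.div_const a).mono_left (nhdsWithin_le_nhds (a := (0 : ℝ)))
      · filter_upwards [self_mem_nhdsWithin] with b hb using div_pos hb ha
    have h2 : Tendsto (fun b => a * Φ (b / a)) (𝓝[>] 0) (𝓝[>] 0) := by
      refine tendsto_nhdsWithin_iff.mpr ⟨?_, ?_⟩
      · simpa using (hΦ.tendsto_zero.comp h1).const_mul a
      · filter_upwards [self_mem_nhdsWithin] with b hb
        exact mul_pos ha (hΦ.pos _ (div_pos hb ha))
    have h3 : Tendsto (fun b => f a * Φ (f b / f a)) (𝓝[>] 0) (𝓝 (f a * Φ (l / f a))) :=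
      tendsto_const_nhds.mul ((hΦ.continuousOn.continuousAt
        (Ioi_mem_nhds (div_pos hl (hf a ha)))).tendsto.comp (hlim.div_const _))
    have h4 : l = f a * Φ (l / f a) := by
      refine tendsto_nhds_unique_of_eventuallyEq (hlim.comp h2) h3 ?_
      filter_upwards [self_mem_nhdsWithin] with b hb using h a b ha hb
    have h5 : Φ (l / f a) = l / f a := by
      rw [eq_div_iff (hf a ha).ne', mul_comm, ← h4]
    exact ((div_eq_one_iff_eq (hf a ha).ne').mp
      ((hΦ.eq_self_iff _ (div_pos hl (hf a ha))).mp h5)).symm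
  intro x hx
  rw [hconst x hx, ← hconst 1 one_pos, hf1]

lemma exists_affine {h : ℝ → ℝ} (hpos : ∀ x, 0 < x → 0 < h x) (h1 : h 1 = 1)
    (haff : ∀ x y l, 0 < x → 0 < y → l ∈ Ioo (0 : ℝ) 1 →
      h (l * x + (1 - l) * y) = l * h x + (1 - l) * h y) :
    ∃ p q : ℝ, 0 ≤ p ∧ 0 ≤ q ∧ p + q = 1 ∧ ∀ x, 0 < x → h x = p * x + q := by
  set p := h 2 - 1 with hp
  have key (x : ℝ) (hx : 0 < x) : h x = p * x + (1 - p) := by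
    rcases lt_trichotomy x 1 with hx1 | rfl | hx1
    · have hd : (0 : ℝ) < 2 - x := by linarith
      have := haff x 2 (1 / (2 - x)) hx two_pos
        ⟨by positivity, by rw [div_lt_one hd]; linarith⟩
      rw [show 1 / (2 - x) * x + (1 - 1 / (2 - x)) * 2 = 1 by field_simp; ring, h1] at this
      field_simp at this
      rw [hp]
      linarith
    · linarith
    · rcases lt_trichotomy x 2 with hx2 | rfl | hx2
      · have := haff 1 2 (2 - x) one_pos two_pos ⟨by linarith, by linarith⟩
        rw [show (2 - x) * 1 + (1 - (2 - x)) * 2 = x by ring, h1] at this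
        rw [hp]
        linarith
      · linarith
      · have hd : (0 : ℝ) < x - 1 := by linarith
        have := haff x 1 (1 / (x - 1)) hx one_pos
          ⟨by positivity, by rw [div_lt_one hd]; linarith⟩
        rw [show 1 / (x - 1) * x + (1 - 1 / (x - 1)) * 1 = 2 by field_simp; ring, h1] at this
        field_simp at this
        rw [hp]
        linarith
  refine ⟨p, 1 - p, ?_, ?_, by ring, key⟩
  · by_contra! hneg
    have hx : 0 < (1 - p) / (-p) := div_pos (by linarith) (by linarith)
    have h0 := hpos _ hx
    rw [key _ hx] at h0
    have : p * ((1 - p) / (-p)) = -(1 - p) := by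
      have := hneg.ne
      field_simp
    linarith
  · by_contra! hneg
    have hp0 : 0 < p := by linarith
    have hx : 0 < -(1 - p) / p := div_pos (by linarith) hp0
    have h0 := hpos _ hx
    rw [key _ hx, mul_div_cancel₀ _ hp0.ne'] at h0
    linarith

end Scalar

section PowerMean

variable {r α : ℝ}

lemma powerRep_pos (hα : α ∈ Ioo (0 : ℝ) 1) (x : ℝ) (hx : 0 < x) : 0 < powerRep r α x := by
  have h1 : 0 < 1 - α := sub_pos.mpr hα.2
  have h0 := hα.1
  unfold powerRep
  split_ifs <;> positivity

lemma powerRep_one : powerRep r α 1 = 1 := by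
  simp [powerRep]

lemma adjFun_powerRep (hα : α ∈ Ioo (0 : ℝ) 1) (x : ℝ) (hx : 0 < x) :
    adjFun (powerRep r α) x = powerRep (-r) α x := by
  have h1 : 0 < 1 - α := sub_pos.mpr hα.2
  have h0 := hα.1
  by_cases hr : r = 0
  · simp [adjFun, powerRep, hr, Real.inv_rpow hx.le]
  · have hb : 0 ≤ α * x⁻¹ ^ r + (1 - α) := by positivity
    simp only [adjFun, powerRep, hr, neg_eq_zero, if_false]
    rw [← Real.rpow_neg hb, Real.inv_rpow hx.le, ← Real.rpow_neg hx.le, one_div, one_div, inv_neg]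

lemma strictMeanRep_powerRep (hr : r ≤ 0) (hα : α ∈ Ioo (0 : ℝ) 1) :
    StrictMeanRep (powerRep r α) := by
  obtain ⟨h0, h1⟩ := id hα
  have h1' : 0 < 1 - α := sub_pos.mpr h1
  rcases hr.eq_or_lt with rfl | hr
  · have e : powerRep 0 α = fun t => t ^ α := by
      funext t
      simp [powerRep]
    refine ⟨powerRep_pos hα, ?_, ?_, powerRep_one, ?_, ?_, ?_⟩ <;> rw [e]
    · exact (Real.continuous_rpow_const h0.le).continuousOn
    · simpa [h0.ne'] using ((Real.continuous_rpow_const h0.le).tendsto 0).mono_left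
        (nhdsWithin_le_nhds (s := Ioi 0))
    · exact fun x hx => Real.one_lt_rpow hx h0
    · exact fun x hx => Real.rpow_lt_self_of_one_lt hx h1
    · exact fun x hx hx1 => Real.self_lt_rpow_of_lt_one hx hx1 h1
  · have e : powerRep r α = fun t => (α * t ^ r + (1 - α)) ^ (1 / r) := by
      funext t
      simp only [powerRep, hr.ne, if_false]
    have hr' : 1 / r < 0 := one_div_neg.mpr hr
    have inv_pow {x : ℝ} (hx : 0 < x) : (x ^ r) ^ (1 / r) = x := by
      rw [one_div, Real.rpow_rpow_inv hx.le hr.ne]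
    refine ⟨powerRep_pos hα, ?_, ?_, powerRep_one, ?_, ?_, ?_⟩ <;> rw [e]
    · intro x (hx : 0 < x)
      have hb : 0 < α * x ^ r + (1 - α) := by positivity
      refine ContinuousAt.continuousWithinAt ?_
      exact (((Real.continuousAt_rpow_const x r (Or.inl hx.ne')).const_mul α).add_const _).rpow_const
        (Or.inl hb.ne')
    · have h2 : Tendsto (fun t : ℝ => α * t ^ r + (1 - α)) (𝓝[>] 0) atTop :=
        tendsto_atTop_add_const_right _ _ ((tendsto_rpow_neg_nhdsGT_zero hr).const_mul_atTop h0)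
      have h3 := (tendsto_rpow_neg_atTop (neg_pos.mpr hr')).comp h2
      simpa only [neg_neg, Function.comp_def] using h3
    · intro x hx
      have hx0 : 0 < x := one_pos.trans hx
      have := Real.rpow_lt_one_of_one_lt_of_neg hx hr
      exact Real.one_lt_rpow_of_pos_of_lt_one_of_neg (by positivity) (by nlinarith) hr'
    · intro x hx
      have hx0 : 0 < x := one_pos.trans hx
      have := Real.rpow_lt_one_of_one_lt_of_neg hx hr
      conv_rhs => rw [← inv_pow hx0]
      exact Real.rpow_lt_rpow_of_neg (by positivity) (by nlinarith) hr'
    · intro x hx0 hx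
      have := Real.one_lt_rpow_of_pos_of_lt_one_of_neg hx0 hx hr
      conv_lhs => rw [← inv_pow hx0]
      exact Real.rpow_lt_rpow_of_neg (by positivity) (by nlinarith) hr'

/-- Strict concavity of power means of order in `[0, 1)`: a genuinely affine function does not
commute with them. -/
lemma powerRep_affine_ne {p q : ℝ} (hr : r ∈ Ico (0 : ℝ) 1) (hα : α ∈ Ioo (0 : ℝ) 1)
    (hp : 0 < p) (hq : 0 < q) (hpq : p + q = 1) :
    p * powerRep r α 2 + q ≠ powerRep r α (p * 2 + q) := by
  obtain ⟨h0, h1⟩ := id hα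
  have h1' : 0 < 1 - α := sub_pos.mpr h1
  rcases hr.1.eq_or_lt with rfl | hr0
  · have := (Real.strictConcaveOn_rpow h0 h1).2 (x := 2) (y := 1) (by simp) (by simp)
      (by norm_num) hp hq hpq
    simp only [smul_eq_mul, Real.one_rpow, mul_one] at this
    simpa [powerRep] using this.ne
  have hconc := Real.strictConcaveOn_rpow hr0 hr.2
  have hne := hr0.ne'
  have hM0 : 0 < powerRep r α 2 := powerRep_pos hα 2 two_pos
  have hN0 : 0 < p * 2 + q := by positivity
  have pow_eq {x : ℝ} (hx : 0 < x) : powerRep r α x ^ r = α * x ^ r + (1 - α) := by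
    simp only [powerRep, hne, if_false]
    rw [one_div, Real.rpow_inv_rpow (by positivity) hne]
  have hM := pow_eq two_pos
  have hN := pow_eq hN0
  set M := powerRep r α 2
  intro heq
  rw [← heq] at hN
  have hM1 : M ≠ 1 := by
    rintro hM1
    have := Real.one_lt_rpow one_lt_two hr0
    rw [hM1, Real.one_rpow] at hM
    nlinarith
  have hK : 0 < p * M + q := by positivity
  set K := p * M + q with hKdef
  have hθ : p * M / K + q / K = 1 := by rw [← add_div, div_self hK.ne']
  have hw : 0 < p * M / K := by positivity
  have hw' : 0 < q / K := by positivity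
  have mem {x : ℝ} (hx : 0 < x) : x ∈ Ici (0 : ℝ) := hx.le
  have e1 := hconc.concaveOn.2 (mem (div_pos two_pos hM0)) (mem one_pos) hw.le hw'.le hθ
  have e2 := hconc.2 (mem (div_pos one_pos hM0)) (mem one_pos)
    (by rw [ne_eq, div_eq_one_iff_eq hM0.ne']; exact hM1.symm) hw hw' hθ
  simp only [smul_eq_mul, Real.one_rpow, mul_one] at e1 e2
  rw [show p * M / K * (2 / M) + q / K = (p * 2 + q) / K by field_simp,
    Real.div_rpow two_pos.le hM0.le, Real.div_rpow hN0.le hK.le] at e1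
  rw [show p * M / K * (1 / M) + q / K = 1 / K by field_simp; exact hpq,
    Real.div_rpow zero_le_one hM0.le, Real.div_rpow zero_le_one hK.le, Real.one_rpow] at e2
  have hMr : 0 < M ^ r := Real.rpow_pos_of_pos hM0 r
  have hKr : 0 < K ^ r := Real.rpow_pos_of_pos hK r
  have sum := add_lt_add_of_le_of_lt (mul_le_mul_of_nonneg_left e1 h0.le)
    (mul_lt_mul_of_pos_left e2 h1')
  have hL : α * (p * M / K * (2 ^ r / M ^ r) + q / K) + (1 - α) * (p * M / K * (1 / M ^ r) + q / K)
      = 1 := by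
    calc _ = p * M / K * ((α * 2 ^ r + (1 - α)) / M ^ r) + q / K := by ring
      _ = 1 := by rw [← hM, div_self hMr.ne', mul_one, hθ]
  have hR : α * ((p * 2 + q) ^ r / K ^ r) + (1 - α) * (1 / K ^ r) = 1 := by
    calc _ = (α * (p * 2 + q) ^ r + (1 - α)) / K ^ r := by ring
      _ = 1 := by rw [← hN, div_self hKr.ne']
  linarith

end PowerMean

lemma trivial_of_adjFun_trivial {f : ℝ → ℝ} (h : OMTrivial (adjFun f)) : OMTrivial f := by
  have inv_eq (x : ℝ) : f x = (adjFun f x⁻¹)⁻¹ := by simp [adjFun]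
  rcases h with h | h
  · exact Or.inl fun x hx => by rw [inv_eq, h _ (inv_pos.mpr hx), inv_one]
  · exact Or.inr fun x hx => by rw [inv_eq, h _ (inv_pos.mpr hx), inv_inv]

lemma preservesMean_congr {Φ Ψ f : ℝ → ℝ} (hf : ∀ x, 0 < x → 0 < f x)
    (hΦΨ : ∀ x, 0 < x → Φ x = Ψ x) (h : PreservesMean Φ f) : PreservesMean Ψ f := by
  intro n A B hA hB
  rw [← kuboMean_congr hA hB hΦΨ,
    ← kuboMean_congr (matFun_posDef hA hf) (matFun_posDef hB hf) hΦΨ]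
  exact h n A B hA hB

lemma trivial_of_preservesMean_powerRep {r α : ℝ} {f : ℝ → ℝ} (hr : r ∈ Ioc (-1 : ℝ) 0)
    (hα : α ∈ Ioo (0 : ℝ) 1) (hf : ∀ x, 0 < x → 0 < f x) (hf1 : f 1 = 1)
    (hmono : MonotoneOn f (Ioi 0)) (h : PreservesMean (powerRep r α) f) : OMTrivial f := by
  have hΦ := strictMeanRep_powerRep hr.2 hα
  have hscal (a b : ℝ) (ha : 0 < a) (hb : 0 < b) := preservesMean_scalar hf h ha hb
  rcases eq_one_or_tendsto_zero hΦ hf hf1 hmono hscal with hone | hzero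
  · exact Or.inl hone
  have hfc := continuous_extendZero (continuousOn_of_scalar_mean hΦ hf hmono hscal) hzero
  have hΦc := continuous_extendZero hΦ.continuousOn hΦ.tendsto_zero
  have hadj (x : ℝ) (hx : 0 < x) : 0 < adjFun f x := inv_pos.mpr (hf _ (inv_pos.mpr hx))
  obtain ⟨p, q, hp, hq, hpq, haff⟩ := exists_affine hadj (by simp [adjFun, hf1])
    fun x y l hx hy hl => adjFun_affine_of_preservesMean h hΦ.pos hΦ.eq_self_iff hf hΦc hfc hx hy hl
  apply trivial_of_adjFun_trivial
  rcases hp.eq_or_lt with rfl | hp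
  · exact Or.inl fun x hx => by rw [haff x hx]; linarith
  rcases hq.eq_or_lt with rfl | hq
  · exact Or.inr fun x hx => by rw [haff x hx, add_zero, show p = 1 by linarith, one_mul]
  have hpres := preservesMean_congr hadj (adjFun_powerRep hα) (preservesMean_adjFun hΦ.pos hf h)
  have := preservesMean_scalar hadj hpres one_pos two_pos
  rw [haff 1 one_pos, haff 2 two_pos, mul_one, hpq, one_mul, one_mul, div_one, div_one,
    haff _ (powerRep_pos hα 2 two_pos)] at this
  exact absurd this
    (powerRep_affine_ne ⟨by linarith [hr.2], by linarith [hr.1]⟩ hα hp hq hpq)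

theorem stmt_15 (r α : ℝ) (hr : r ∈ Set.Ioo (-1 : ℝ) 1) (hα : α ∈ Set.Ioo (0 : ℝ) 1)
    (f : ℝ → ℝ) (hf : OMone f) :
    PreservesMean (powerRep r α) f ↔ OMTrivial f := by
  obtain ⟨hpos, hf1, hop⟩ := hf
  refine ⟨fun h => ?_, preservesMean_of_trivial (powerRep_pos hα) powerRep_one⟩
  have hmono := monotoneOn_of_opMonotone hop
  rcases le_or_gt r 0 with hr0 | hr0
  · exact trivial_of_preservesMean_powerRep ⟨hr.1, hr0⟩ hα hpos hf1 hmono h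
  have hadj (x : ℝ) (hx : 0 < x) : 0 < adjFun f x := inv_pos.mpr (hpos _ (inv_pos.mpr hx))
  refine trivial_of_adjFun_trivial <| trivial_of_preservesMean_powerRep (r := -r)
    ⟨by linarith [hr.2], by linarith⟩ hα hadj (by simp [adjFun, hf1]) (fun x hx y hy hxy => ?_) <|
    preservesMean_congr hadj (adjFun_powerRep hα)
      (preservesMean_adjFun (powerRep_pos hα) hpos h)
  have hx' : 0 < x⁻¹ := inv_pos.mpr hx
  have hy' : 0 < y⁻¹ := inv_pos.mpr hy
  exact inv_anti₀ (hpos _ hy') (hmono hy' hx' (inv_anti₀ hx hxy))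
end

section
/- For every p ∈ (0,1) and every t > 0 with t ≠ 1, the Petz–Hasegawa function satisfies (t − 1)/log t ≤ PH_p(t) ≤ PH_{1/2}(t) = ((1 + √t)/2)^2 < (1 + t)/2. -/
open Matrix Filter Set Topology
open scoped ComplexOrder

noncomputable def PH (p t : ℝ) : ℝ :=
  p * (1 - p) * (t - 1) ^ 2 / ((t ^ p - 1) * (t ^ (1 - p) - 1))

theorem convexOn_sinh : ConvexOn ℝ (Ici 0) Real.sinh := by
  refine MonotoneOn.convexOn_of_deriv (convex_Ici 0) Real.continuous_sinh.continuousOn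
    Real.differentiable_sinh.differentiableOn ?_
  rw [Real.deriv_sinh, interior_Ici]
  intro x hx y hy hxy
  rw [Real.cosh_le_cosh, abs_of_pos hx, abs_of_pos hy]
  exact hxy

theorem sinh_le_mul_cosh {x : ℝ} (hx : 0 ≤ x) : Real.sinh x ≤ x * Real.cosh x := by
  rcases hx.eq_or_lt with rfl | hx
  · simp
  · have h := convexOn_sinh.slope_le_deriv (mem_Ici.2 le_rfl) (mem_Ici.2 hx.le) hx
      Real.differentiableAt_sinh
    rw [Real.deriv_sinh, slope_def_field, Real.sinh_zero, sub_zero, sub_zero,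
      div_le_iff₀ hx] at h
    linarith

theorem sinh_mul_le {c x : ℝ} (hc₀ : 0 ≤ c) (hc₁ : c ≤ 1) (hx : 0 ≤ x) :
    Real.sinh (c * x) ≤ c * Real.sinh x := by
  simpa using convexOn_sinh.2 (mem_Ici.2 hx) (mem_Ici.2 le_rfl) hc₀ (sub_nonneg.2 hc₁)
    (add_sub_cancel c 1)

theorem sinh_sq_abs (x : ℝ) : Real.sinh |x| ^ 2 = Real.sinh x ^ 2 := by
  rw [← Real.abs_sinh, sq_abs]

theorem sinh_mul_sq_le {c : ℝ} (hc : |c| ≤ 1) (x : ℝ) :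
    Real.sinh (c * x) ^ 2 ≤ c ^ 2 * Real.sinh x ^ 2 := by
  rw [← sinh_sq_abs (c * x), ← sinh_sq_abs x, abs_mul, ← sq_abs c, ← mul_pow]
  exact pow_le_pow_left₀ (Real.sinh_nonneg_iff.2 (by positivity))
    (sinh_mul_le (abs_nonneg c) hc (abs_nonneg x)) 2

theorem sinh_add_mul_sinh_sub (x y : ℝ) :
    Real.sinh (x + y) * Real.sinh (x - y) = Real.sinh x ^ 2 - Real.sinh y ^ 2 := by
  rw [Real.sinh_add, Real.sinh_sub]
  linear_combination Real.sinh x ^ 2 * Real.cosh_sq y - Real.sinh y ^ 2 * Real.cosh_sq x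

theorem mul_sinh_half_sq_le {p : ℝ} (hp₀ : 0 ≤ p) (hp₁ : p ≤ 1) (x : ℝ) :
    4 * (p * (1 - p)) * Real.sinh (x / 2) ^ 2 ≤ Real.sinh (p * x) * Real.sinh ((1 - p) * x) := by
  have hprod := sinh_add_mul_sinh_sub (x / 2) ((2 * p - 1) * (x / 2))
  rw [show x / 2 + (2 * p - 1) * (x / 2) = p * x by ring,
    show x / 2 - (2 * p - 1) * (x / 2) = (1 - p) * x by ring] at hprod
  have hle := sinh_mul_sq_le (c := 2 * p - 1) (abs_le.2 ⟨by linarith, by linarith⟩) (x / 2)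
  linarith

theorem add_mul_sinh_mul_sinh_le {a b : ℝ} (ha : 0 ≤ a) (hb : 0 ≤ b) :
    (a + b) * (Real.sinh a * Real.sinh b) ≤ a * b * Real.sinh (a + b) := by
  rw [Real.sinh_add]
  have h₁ := mul_le_mul_of_nonneg_left (sinh_le_mul_cosh hb)
    (mul_nonneg ha (Real.sinh_nonneg_iff.2 ha))
  have h₂ := mul_le_mul_of_nonneg_left (sinh_le_mul_cosh ha)
    (mul_nonneg hb (Real.sinh_nonneg_iff.2 hb))
  linarith

theorem sinh_mul_mul_sinh_le {p x : ℝ} (hp₀ : 0 ≤ p) (hp₁ : p ≤ 1) (hx : x ≠ 0) :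
    Real.sinh (p * x) * Real.sinh ((1 - p) * x) ≤ p * (1 - p) * (x * Real.sinh x) := by
  have pos_case : ∀ y : ℝ, 0 < y →
      Real.sinh (p * y) * Real.sinh ((1 - p) * y) ≤ p * (1 - p) * (y * Real.sinh y) := by
    intro y hy
    have h := add_mul_sinh_mul_sinh_le (mul_nonneg hp₀ hy.le)
      (mul_nonneg (sub_nonneg.2 hp₁) hy.le)
    rw [← add_mul, add_sub_cancel, one_mul] at h
    refine le_of_mul_le_mul_left ?_ hy
    linarith
  rcases hx.lt_or_gt with hx | hx
  · simpa [mul_neg, neg_mul, Real.sinh_neg] using pos_case (-x) (neg_pos.2 hx)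
  · exact pos_case x hx

theorem exp_two_mul_sub_one (x : ℝ) :
    Real.exp (2 * x) - 1 = 2 * Real.exp x * Real.sinh x := by
  have h : Real.exp x * Real.exp (-x) = 1 := by rw [← Real.exp_add]; simp
  rw [Real.sinh_eq, two_mul, Real.exp_add]
  linear_combination h

theorem sinh_mul_mul_sinh_pos {p x : ℝ} (hp₀ : 0 < p) (hp₁ : p < 1) (hx : x ≠ 0) :
    0 < Real.sinh (p * x) * Real.sinh ((1 - p) * x) := by
  have hsq : 0 < Real.sinh (x / 2) ^ 2 :=
    sq_pos_of_ne_zero (Real.sinh_ne_zero.2 (by simpa using hx))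
  have hpq : 0 < p * (1 - p) := mul_pos hp₀ (sub_pos.2 hp₁)
  exact (by positivity : 0 < 4 * (p * (1 - p)) * Real.sinh (x / 2) ^ 2).trans_le
    (mul_sinh_half_sq_le hp₀.le hp₁.le x)

theorem PH_exp_two_mul (p x : ℝ) :
    PH p (Real.exp (2 * x)) = p * (1 - p) * (Real.exp x * Real.sinh x ^ 2) /
      (Real.sinh (p * x) * Real.sinh ((1 - p) * x)) := by
  have h : Real.exp x = Real.exp (p * x) * Real.exp ((1 - p) * x) := by
    rw [← Real.exp_add]; ring_nf
  have hden : (Real.exp (2 * (p * x)) - 1) * (Real.exp (2 * ((1 - p) * x)) - 1) =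
      4 * Real.exp x * (Real.sinh (p * x) * Real.sinh ((1 - p) * x)) := by
    rw [exp_two_mul_sub_one, exp_two_mul_sub_one, h]
    ring
  rw [PH, ← Real.exp_mul, ← Real.exp_mul, show 2 * x * p = 2 * (p * x) by ring,
    show 2 * x * (1 - p) = 2 * ((1 - p) * x) by ring, hden, exp_two_mul_sub_one,
    ← mul_div_mul_left (p * (1 - p) * (Real.exp x * Real.sinh x ^ 2)) _
      (by positivity : 4 * Real.exp x ≠ 0)]
  ring_nf

theorem PH_half_exp_two_mul {x : ℝ} (hx : x ≠ 0) :
    PH (1 / 2) (Real.exp (2 * x)) = Real.exp x * Real.cosh (x / 2) ^ 2 := by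
  have hs : Real.sinh (x / 2) ≠ 0 := Real.sinh_ne_zero.2 (by simpa using hx)
  have hd : Real.sinh x = 2 * Real.sinh (x / 2) * Real.cosh (x / 2) := by
    rw [← Real.sinh_two_mul, mul_div_cancel₀ x two_ne_zero]
  rw [PH_exp_two_mul, show (1 - 1 / 2 : ℝ) = 1 / 2 by norm_num,
    show 1 / 2 * x = x / 2 by ring, hd]
  field_simp

theorem exp_mul_cosh_half_sq (x : ℝ) :
    Real.exp x * Real.cosh (x / 2) ^ 2 = ((1 + Real.exp x) / 2) ^ 2 := by
  have h : Real.exp x = Real.exp (x / 2) ^ 2 := by rw [← Real.exp_nat_mul]; push_cast; ring_nf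
  rw [Real.cosh_eq, Real.exp_neg, h]
  field_simp
  ring

theorem PH_le_PH_half {p x : ℝ} (hp₀ : 0 < p) (hp₁ : p < 1) (hx : x ≠ 0) :
    PH p (Real.exp (2 * x)) ≤ PH (1 / 2) (Real.exp (2 * x)) := by
  have hd : Real.sinh x = 2 * Real.sinh (x / 2) * Real.cosh (x / 2) := by
    rw [← Real.sinh_two_mul, mul_div_cancel₀ x two_ne_zero]
  rw [PH_half_exp_two_mul hx, PH_exp_two_mul,
    div_le_iff₀ (sinh_mul_mul_sinh_pos hp₀ hp₁ hx), hd]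
  have h := mul_le_mul_of_nonneg_left (mul_sinh_half_sq_le hp₀.le hp₁.le x)
    (by positivity : 0 ≤ Real.exp x * Real.cosh (x / 2) ^ 2)
  linarith

theorem logarithmic_mean_le_PH {p x : ℝ} (hp₀ : 0 < p) (hp₁ : p < 1) (hx : x ≠ 0) :
    (Real.exp (2 * x) - 1) / Real.log (Real.exp (2 * x)) ≤ PH p (Real.exp (2 * x)) := by
  have hlm : (Real.exp (2 * x) - 1) / Real.log (Real.exp (2 * x)) =
      Real.exp x * (Real.sinh x / x) := by
    rw [Real.log_exp, exp_two_mul_sub_one]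
    field_simp
  rw [hlm, PH_exp_two_mul, le_div_iff₀ (sinh_mul_mul_sinh_pos hp₀ hp₁ hx)]
  have hratio : 0 ≤ Real.sinh x / x := by
    rcases hx.lt_or_gt with hx | hx
    · exact div_nonneg_of_nonpos (Real.sinh_nonpos_iff.2 hx.le) hx.le
    · exact div_nonneg (Real.sinh_nonneg_iff.2 hx.le) hx.le
  calc Real.exp x * (Real.sinh x / x) * (Real.sinh (p * x) * Real.sinh ((1 - p) * x))
      ≤ Real.exp x * (Real.sinh x / x) * (p * (1 - p) * (x * Real.sinh x)) :=
        mul_le_mul_of_nonneg_left (sinh_mul_mul_sinh_le hp₀.le hp₁.le hx) (by positivity)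
    _ = p * (1 - p) * (Real.exp x * Real.sinh x ^ 2) := by field_simp

theorem stmt_18 (p : ℝ) (hp : p ∈ Set.Ioo (0 : ℝ) 1) (t : ℝ) (ht : 0 < t) (ht1 : t ≠ 1) :
    (t - 1) / Real.log t ≤ PH p t ∧ PH p t ≤ PH (1 / 2) t ∧
      PH (1 / 2) t = ((1 + Real.sqrt t) / 2) ^ 2 ∧
      ((1 + Real.sqrt t) / 2) ^ 2 < (1 + t) / 2 := by
  obtain ⟨x, rfl⟩ : ∃ x, Real.exp (2 * x) = t :=
    ⟨Real.log t / 2, by rw [mul_div_cancel₀ _ two_ne_zero, Real.exp_log ht]⟩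
  have hx : x ≠ 0 := by
    rintro rfl
    simp at ht1
  have hsqrt : Real.sqrt (Real.exp (2 * x)) = Real.exp x := by
    rw [two_mul, Real.exp_add, Real.sqrt_mul_self (Real.exp_pos x).le]
  refine ⟨logarithmic_mean_le_PH hp.1 hp.2 hx, PH_le_PH_half hp.1 hp.2 hx, ?_, ?_⟩
  · rw [PH_half_exp_two_mul hx, exp_mul_cosh_half_sq, hsqrt]
  · have hne : Real.exp x - 1 ≠ 0 := sub_ne_zero.2 (mt (Real.exp_eq_one_iff x).1 hx)
    rw [hsqrt, two_mul x, Real.exp_add]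
    linarith [sq_pos_of_ne_zero hne]
end
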